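/- In the (t,R)-parametrized model, the second partial derivative of the average free entropy fₙ(t,R) = (1/n) E ln Z_{t,R} with respect to R_u satisfies, for all t ∈ [0,1] and R ∈ (0,∞)²: ∂²fₙ/∂R_u² |_{t,R} = n · E⟨ (𝓛 − ⟨𝓛⟩_{t,R})² ⟩_{t,R} − (1/(4 R_u)) √(α_u/R_u) · E[ ⟨v⟩_{t,R}ᵀ Z̄ ] / n, and the correction term satisfies (1/(4R_u))√(α_u/R_u) · E[⟨v⟩_{t,R}ᵀ Z̄]/n = (α_u/(4 R_u)) · ( E⟨‖v‖²⟩_{t,R} − E‖⟨v⟩_{t,R}‖² ) / n ≤ (α_u ρ_v n_v)/(4 R_u n). -/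

import Mathlib

open MeasureTheory Real Filter Set

noncomputable section

/-- i.i.d. standard Gaussian measure on `Fin n → ℝ`. -/
def stdGaussian (n : ℕ) : Measure (Fin n → ℝ) :=
  Measure.pi fun _ : Fin n => ProbabilityTheory.gaussianReal 0 1

/-- i.i.d. standard Gaussian measure on matrices `Fin p → Fin q → ℝ`. -/
def stdGaussianMat (p q : ℕ) : Measure (Fin p → Fin q → ℝ) :=
  Measure.pi fun _ : Fin p => stdGaussian q

/-- `P` is the uniform (rotation-invariant) probability measure on the sphere of
radius `r` centered at the origin in `ℝⁿ`. -/
def IsUniformSphere (n : ℕ) (r : ℝ) (P : Measure (Fin n → ℝ)) : Prop :=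
  IsProbabilityMeasure P ∧
  (∀ᵐ x ∂P, ∑ i, (x i) ^ 2 = r ^ 2) ∧
  ∀ O : Matrix (Fin n) (Fin n) ℝ, O ∈ Matrix.orthogonalGroup (Fin n) ℝ →
    P.map (fun x => O.mulVec x) = P

/-- The interpolating Hamiltonian `H_{t,R}(u,v)`, with the observations
`Y^{(t)} = √((1−t)/n) U Vᵀ + Z`, `Ỹ = √(α_v R_v) U + Z̃`, `Ȳ = √(α_u R_u) V + Z̄`
substituted. -/
def interpH (n nu nv : ℕ) (au av t Ru Rv : ℝ)
    (U : Fin nu → ℝ) (V : Fin nv → ℝ) (Z : Fin nu → Fin nv → ℝ)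
    (Zt : Fin nu → ℝ) (Zb : Fin nv → ℝ)
    (u : Fin nu → ℝ) (v : Fin nv → ℝ) : ℝ :=
  (∑ i, ∑ j, ((1 - t) / (2 * n) * (u i) ^ 2 * (v j) ^ 2
      - Real.sqrt ((1 - t) / n) * u i * v j
          * (Real.sqrt ((1 - t) / n) * U i * V j + Z i j)))
  + (∑ i, (av * Rv / 2 * (u i) ^ 2
      - Real.sqrt (av * Rv) * u i * (Real.sqrt (av * Rv) * U i + Zt i)))
  + (∑ j, (au * Ru / 2 * (v j) ^ 2
      - Real.sqrt (au * Ru) * v j * (Real.sqrt (au * Ru) * V j + Zb j)))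

/-- The partition function `Z_{t,R} = ∫∫ e^{−H_{t,R}(u,v)} dP_u(u) dP_v(v)`. -/
def partFun (n nu nv : ℕ) (au av t Ru Rv : ℝ)
    (Pu : Measure (Fin nu → ℝ)) (Pv : Measure (Fin nv → ℝ))
    (U : Fin nu → ℝ) (V : Fin nv → ℝ) (Z : Fin nu → Fin nv → ℝ)
    (Zt : Fin nu → ℝ) (Zb : Fin nv → ℝ) : ℝ :=
  ∫ u, (∫ v, Real.exp (-(interpH n nu nv au av t Ru Rv U V Z Zt Zb u v)) ∂Pv) ∂Pu

/-- The Gibbs bracket `⟨f⟩_{t,R}`, i.e. the expectation of `f(u,v)` under the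
posterior measure proportional to `e^{−H_{t,R}(u,v)} dP_u(u) dP_v(v)`. -/
def gibbs (n nu nv : ℕ) (au av t Ru Rv : ℝ)
    (Pu : Measure (Fin nu → ℝ)) (Pv : Measure (Fin nv → ℝ))
    (U : Fin nu → ℝ) (V : Fin nv → ℝ) (Z : Fin nu → Fin nv → ℝ)
    (Zt : Fin nu → ℝ) (Zb : Fin nv → ℝ)
    (f : (Fin nu → ℝ) → (Fin nv → ℝ) → ℝ) : ℝ :=
  (∫ u, (∫ v, f u v * Real.exp (-(interpH n nu nv au av t Ru Rv U V Z Zt Zb u v)) ∂Pv) ∂Pu)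
    / partFun n nu nv au av t Ru Rv Pu Pv U V Z Zt Zb

/-- Expectation `E` over all the randomness `U ~ P_u`, `V ~ P_v` and the independent
standard Gaussian noises `Z, Z̃, Z̄`. -/
def Efull (nu nv : ℕ)
    (Pu : Measure (Fin nu → ℝ)) (Pv : Measure (Fin nv → ℝ))
    (g : (Fin nu → ℝ) → (Fin nv → ℝ) → (Fin nu → Fin nv → ℝ) →
      (Fin nu → ℝ) → (Fin nv → ℝ) → ℝ) : ℝ :=
  ∫ U, (∫ V, (∫ Z, (∫ Zt, (∫ Zb, g U V Z Zt Zb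
    ∂(stdGaussian nv)) ∂(stdGaussian nu)) ∂(stdGaussianMat nu nv)) ∂Pv) ∂Pu

/-- The average interpolating free entropy `fₙ(t,R) = (1/n) E ln Z_{t,R}`. -/
def interpFreeEntropy (n nu nv : ℕ) (au av t Ru Rv : ℝ)
    (Pu : Measure (Fin nu → ℝ)) (Pv : Measure (Fin nv → ℝ)) : ℝ :=
  (1 / (n : ℝ)) * Efull nu nv Pu Pv (fun U V Z Zt Zb =>
    Real.log (partFun n nu nv au av t Ru Rv Pu Pv U V Z Zt Zb))

/-- The overlap `Q_u = (1/n_u) Σ_i u_i U_i`. -/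
def overlapU (nu : ℕ) (u U : Fin nu → ℝ) : ℝ := (1 / (nu : ℝ)) * ∑ i, u i * U i

/-- The overlap `Q_v = (1/n_v) Σ_j v_j V_j`. -/
def overlapV (nv : ℕ) (v V : Fin nv → ℝ) : ℝ := (1 / (nv : ℝ)) * ∑ j, v j * V j

/-- `E⟨Q_v⟩_{t,R}`. -/
def eQv (n nu nv : ℕ) (au av t Ru Rv : ℝ)
    (Pu : Measure (Fin nu → ℝ)) (Pv : Measure (Fin nv → ℝ)) : ℝ :=
  Efull nu nv Pu Pv (fun U V Z Zt Zb =>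
    gibbs n nu nv au av t Ru Rv Pu Pv U V Z Zt Zb (fun _ v => overlapV nv v V))

/-- `E⟨Q_u⟩_{t,R}`. -/
def eQu (n nu nv : ℕ) (au av t Ru Rv : ℝ)
    (Pu : Measure (Fin nu → ℝ)) (Pv : Measure (Fin nv → ℝ)) : ℝ :=
  Efull nu nv Pu Pv (fun U V Z Zt Zb =>
    gibbs n nu nv au av t Ru Rv Pu Pv U V Z Zt Zb (fun u _ => overlapU nu u U))

/-- The quantity `𝓛 = (1/n) Σ_j [(α_u/2)v_j² − α_u v_j V_j − (1/2)√(α_u/R_u) v_j Z̄_j]`. -/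
def calL (n nv : ℕ) (au Ru : ℝ) (v V Zb : Fin nv → ℝ) : ℝ :=
  (1 / (n : ℝ)) * ∑ j, (au / 2 * (v j) ^ 2 - au * v j * V j
    - 1 / 2 * Real.sqrt (au / Ru) * v j * Zb j)

/-- `E⟨𝓛⟩_{t,R}`. -/
def eL (n nu nv : ℕ) (au av t Ru Rv : ℝ)
    (Pu : Measure (Fin nu → ℝ)) (Pv : Measure (Fin nv → ℝ)) : ℝ :=
  Efull nu nv Pu Pv (fun U V Z Zt Zb =>
    gibbs n nu nv au av t Ru Rv Pu Pv U V Z Zt Zb (fun _ v => calL n nv au Ru v V Zb))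

/-- `φ₀(m) = (m − ln(1+m))/2`. -/
def phi0 (m : ℝ) : ℝ := (m - Real.log (1 + m)) / 2


/-- The thermal variance of `𝓛` : `E⟨(𝓛 − ⟨𝓛⟩)²⟩_{t,R}`. -/
def thermalVarL (n nu nv : ℕ) (au av t Ru Rv : ℝ)
    (Pu : Measure (Fin nu → ℝ)) (Pv : Measure (Fin nv → ℝ)) : ℝ :=
  Efull nu nv Pu Pv (fun U V Z Zt Zb =>
    gibbs n nu nv au av t Ru Rv Pu Pv U V Z Zt Zb (fun _ v =>
      (calL n nv au Ru v V Zb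
        - gibbs n nu nv au av t Ru Rv Pu Pv U V Z Zt Zb
            (fun _ v' => calL n nv au Ru v' V Zb)) ^ 2))

/-- The correction term `(1/(4R_u))√(α_u/R_u) E[⟨v⟩ᵀ Z̄]/n`. -/
def corrTerm (n nu nv : ℕ) (au av t Ru Rv : ℝ)
    (Pu : Measure (Fin nu → ℝ)) (Pv : Measure (Fin nv → ℝ)) : ℝ :=
  (1 / (4 * Ru)) * Real.sqrt (au / Ru) *
    (Efull nu nv Pu Pv (fun U V Z Zt Zb =>
      ∑ j, gibbs n nu nv au av t Ru Rv Pu Pv U V Z Zt Zb (fun _ v => v j) * Zb j))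
    / (n : ℝ)

lemma continuous_tilt {Ω X : Type*} [TopologicalSpace Ω] [TopologicalSpace X]
    {A B C : Ω → X → ℝ} (hA : Continuous A.uncurry) (hB : Continuous B.uncurry)
    (hC : Continuous C.uncurry) :
    Continuous fun p : (ℝ × Ω) × X =>
      A p.1.2 p.2 + p.1.1 ^ 2 * B p.1.2 p.2 + p.1.1 * C p.1.2 p.2 := by
  have := hA.comp (g := A.uncurry) (f := fun p : (ℝ × Ω) × X => (p.1.2, p.2)) (by fun_prop)
  have := hB.comp (g := B.uncurry) (f := fun p : (ℝ × Ω) × X => (p.1.2, p.2)) (by fun_prop)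
  have := hC.comp (g := C.uncurry) (f := fun p : (ℝ × Ω) × X => (p.1.2, p.2)) (by fun_prop)
  simp only [Function.comp_def, Function.uncurry_apply_pair] at *
  fun_prop

lemma continuous_tilt_deriv {Ω X : Type*} [TopologicalSpace Ω] [TopologicalSpace X]
    {B C : Ω → X → ℝ} (hB : Continuous B.uncurry) (hC : Continuous C.uncurry) :
    Continuous fun p : (ℝ × Ω) × X => 2 * p.1.1 * B p.1.2 p.2 + C p.1.2 p.2 := by
  have := hB.comp (g := B.uncurry) (f := fun p : (ℝ × Ω) × X => (p.1.2, p.2)) (by fun_prop)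
  have := hC.comp (g := C.uncurry) (f := fun p : (ℝ × Ω) × X => (p.1.2, p.2)) (by fun_prop)
  simp only [Function.comp_def, Function.uncurry_apply_pair] at *
  fun_prop

lemma abs_tilt_deriv_le {r R b c w : ℝ} (hr : |r| ≤ R) (hb : |b| ≤ w) (hc : |c| ≤ w) :
    |2 * r * b + c| ≤ (2 * R + 1) * w := by
  have hw : 0 ≤ w := (abs_nonneg _).trans hb
  have hR : 0 ≤ R := (abs_nonneg _).trans hr
  calc |2 * r * b + c| ≤ |2 * r * b| + |c| := abs_add_le _ _
    _ = 2 * |r| * |b| + |c| := by simp [abs_mul]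
    _ ≤ 2 * R * w + w := by gcongr
    _ = _ := by ring

lemma abs_le_of_mem_closedBall_one {r s : ℝ} (hr : r ∈ Metric.closedBall s 1) :
    |r| ≤ |s| + 1 := by
  have := abs_sub_abs_le_abs_sub r s
  rw [Metric.mem_closedBall, Real.dist_eq] at hr
  linarith

section GibbsMean

variable {X : Type*} [MeasurableSpace X]

/-- The mean of `f` under the probability measure proportional to `exp h dμ`. -/
def gibbsMean (μ : Measure X) (f h : X → ℝ) : ℝ :=
  (∫ x, f x * Real.exp (h x) ∂μ) / ∫ x, Real.exp (h x) ∂μ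

lemma gibbsMean_const_mul {μ : Measure X} (c : ℝ) (f h : X → ℝ) :
    gibbsMean μ (fun x => c * f x) h = c * gibbsMean μ f h := by
  simp_rw [gibbsMean, mul_assoc, integral_const_mul, mul_div_assoc]

variable [TopologicalSpace X] [OpensMeasurableSpace X]
  {μ : Measure X} [IsProbabilityMeasure μ] {K : Set X}

lemma integrable_of_continuous_of_ae_mem_compact (hK : IsCompact K) (hμ : ∀ᵐ x ∂μ, x ∈ K)
    {f : X → ℝ} (hf : Continuous f) : Integrable f μ := by
  obtain ⟨C, hC⟩ := hK.exists_bound_of_continuousOn hf.continuousOn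
  exact Integrable.of_bound hf.aestronglyMeasurable C (hμ.mono fun x hx => hC x hx)

lemma integral_exp_pos_of_continuous (hK : IsCompact K) (hμ : ∀ᵐ x ∂μ, x ∈ K)
    {h : X → ℝ} (hh : Continuous h) : 0 < ∫ x, Real.exp (h x) ∂μ :=
  integral_exp_pos (integrable_of_continuous_of_ae_mem_compact hK hμ (by fun_prop))

lemma abs_gibbsMean_le (hK : IsCompact K) (hμ : ∀ᵐ x ∂μ, x ∈ K) {f h : X → ℝ}
    (hf : Continuous f) (hh : Continuous h) {M : ℝ} (hM : ∀ x ∈ K, |f x| ≤ M) :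
    |gibbsMean μ f h| ≤ M := by
  have hpos := integral_exp_pos_of_continuous hK hμ hh
  have hint : ∀ {g : X → ℝ}, Continuous g → Integrable g μ :=
    integrable_of_continuous_of_ae_mem_compact hK hμ
  rw [gibbsMean, abs_div, abs_of_pos hpos, div_le_iff₀ hpos, ← integral_const_mul]
  refine (abs_integral_le_integral_abs).trans
    (integral_mono_ae (hint (by fun_prop)) (hint (by fun_prop)) ?_)
  filter_upwards [hμ] with x hx
  rw [abs_mul, abs_of_pos (Real.exp_pos _)]
  exact mul_le_mul_of_nonneg_right (hM x hx) (Real.exp_pos _).le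

lemma abs_log_integral_exp_le (hK : IsCompact K) (hμ : ∀ᵐ x ∂μ, x ∈ K) {h : X → ℝ}
    (hh : Continuous h) {M : ℝ} (hM : ∀ x ∈ K, |h x| ≤ M) :
    |Real.log (∫ x, Real.exp (h x) ∂μ)| ≤ M := by
  have hpos := integral_exp_pos_of_continuous hK hμ hh
  have hint := integrable_of_continuous_of_ae_mem_compact hK hμ (f := fun x => Real.exp (h x))
    (by fun_prop)
  rw [abs_le, Real.le_log_iff_exp_le hpos, Real.log_le_iff_le_exp hpos]
  constructor
  · calc Real.exp (-M) = ∫ _, Real.exp (-M) ∂μ := by simp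
      _ ≤ _ := integral_mono_ae (integrable_const _) hint
        (hμ.mono fun x hx => Real.exp_le_exp.2 (abs_le.1 (hM x hx)).1)
  · calc ∫ x, Real.exp (h x) ∂μ
      _ ≤ ∫ _, Real.exp M ∂μ := integral_mono_ae hint (integrable_const _)
        (hμ.mono fun x hx => Real.exp_le_exp.2 (abs_le.1 (hM x hx)).2)
      _ = Real.exp M := by simp

lemma gibbsMean_add (hK : IsCompact K) (hμ : ∀ᵐ x ∂μ, x ∈ K) {f g h : X → ℝ}
    (hf : Continuous f) (hg : Continuous g) (hh : Continuous h) :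
    gibbsMean μ (fun x => f x + g x) h = gibbsMean μ f h + gibbsMean μ g h := by
  have hint : ∀ {g : X → ℝ}, Continuous g → Integrable g μ :=
    integrable_of_continuous_of_ae_mem_compact hK hμ
  simp_rw [gibbsMean, add_mul]
  rw [integral_add (hint (by fun_prop)) (hint (by fun_prop)), add_div]

lemma gibbsMean_sum {ι : Type*} (s : Finset ι) (hK : IsCompact K) (hμ : ∀ᵐ x ∂μ, x ∈ K)
    {f : ι → X → ℝ} {h : X → ℝ} (hf : ∀ i, Continuous (f i)) (hh : Continuous h) :
    gibbsMean μ (fun x => ∑ i ∈ s, f i x) h = ∑ i ∈ s, gibbsMean μ (f i) h := by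
  have hint : ∀ {g : X → ℝ}, Continuous g → Integrable g μ :=
    integrable_of_continuous_of_ae_mem_compact hK hμ
  simp_rw [gibbsMean, Finset.sum_mul, ← Finset.sum_div]
  rw [integral_finsetSum s (f := fun i x => f i x * Real.exp (h x)) fun i _ =>
    hint ((hf i).mul (by fun_prop))]

lemma gibbsMean_eq_const (hK : IsCompact K) (hμ : ∀ᵐ x ∂μ, x ∈ K) {f h : X → ℝ}
    (hh : Continuous h) {c : ℝ} (hf : ∀ x ∈ K, f x = c) : gibbsMean μ f h = c := by
  have hpos := integral_exp_pos_of_continuous hK hμ hh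
  rw [gibbsMean, integral_congr_ae (g := fun x => c * Real.exp (h x))
    (hμ.mono fun x hx => by simp [hf x hx]), integral_const_mul, mul_div_assoc,
    div_self hpos.ne', mul_one]

lemma gibbsMean_sub_gibbsMean_sq (hK : IsCompact K) (hμ : ∀ᵐ x ∂μ, x ∈ K) {f h : X → ℝ}
    (hf : Continuous f) (hh : Continuous h) :
    gibbsMean μ (fun x => (f x - gibbsMean μ f h) ^ 2) h
      = gibbsMean μ (fun x => f x ^ 2) h - gibbsMean μ f h ^ 2 := by
  set c := gibbsMean μ f h with hc
  have hsplit : (fun x => (f x - c) ^ 2) = fun x => (f x ^ 2 + (-2 * c) * f x) + c ^ 2 := by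
    ext x; ring
  rw [hsplit, gibbsMean_add hK hμ (by fun_prop) (by fun_prop) hh,
    gibbsMean_add hK hμ (by fun_prop) (by fun_prop) hh, gibbsMean_const_mul, ← hc,
    gibbsMean_eq_const hK hμ hh (fun _ _ => rfl)]
  ring

lemma hasDerivAt_integral_mul_exp (hK : IsCompact K) (hμ : ∀ᵐ x ∂μ, x ∈ K)
    {f f' h h' : ℝ → X → ℝ} (hf : Continuous f.uncurry) (hf' : Continuous f'.uncurry)
    (hh : Continuous h.uncurry) (hh' : Continuous h'.uncurry)
    (df : ∀ s x, HasDerivAt (fun r => f r x) (f' s x) s)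
    (dh : ∀ s x, HasDerivAt (fun r => h r x) (h' s x) s) (s : ℝ) :
    HasDerivAt (fun r => ∫ x, f r x * Real.exp (h r x) ∂μ)
      (∫ x, (f' s x + f s x * h' s x) * Real.exp (h s x) ∂μ) s := by
  have hint : ∀ {g : X → ℝ}, Continuous g → Integrable g μ :=
    integrable_of_continuous_of_ae_mem_compact hK hμ
  have hcont : Continuous fun p : ℝ × X =>
      (f' p.1 p.2 + f p.1 p.2 * h' p.1 p.2) * Real.exp (h p.1 p.2) :=
    (hf'.add (hf.mul hh')).mul (Real.continuous_exp.comp hh)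
  have hcont0 : Continuous fun p : ℝ × X => f p.1 p.2 * Real.exp (h p.1 p.2) :=
    hf.mul (Real.continuous_exp.comp hh)
  obtain ⟨M, hM⟩ := ((isCompact_closedBall s 1).prod hK).exists_bound_of_continuousOn
    hcont.continuousOn
  refine (hasDerivAt_integral_of_dominated_loc_of_deriv_le
    (F := fun r x => f r x * Real.exp (h r x))
    (F' := fun r x => (f' r x + f r x * h' r x) * Real.exp (h r x))
    (bound := fun _ => M)
    (Metric.closedBall_mem_nhds s one_pos) (Eventually.of_forall fun r => ?_) ?_ ?_
    (hμ.mono fun x hx r hr => hM (r, x) ⟨hr, hx⟩) (integrable_const M)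
    (Eventually.of_forall fun x r _ => ?_)).2
  · exact (hcont0.comp (Continuous.prodMk_right r)).aestronglyMeasurable
  · exact hint (hcont0.comp (Continuous.prodMk_right s))
  · exact (hcont.comp (Continuous.prodMk_right s)).aestronglyMeasurable
  · convert! (df r x).mul (dh r x).exp using 1
    ring

lemma hasDerivAt_integral_exp (hK : IsCompact K) (hμ : ∀ᵐ x ∂μ, x ∈ K)
    {h h' : ℝ → X → ℝ} (hh : Continuous h.uncurry) (hh' : Continuous h'.uncurry)
    (dh : ∀ s x, HasDerivAt (fun r => h r x) (h' s x) s) (s : ℝ) :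
    HasDerivAt (fun r => ∫ x, Real.exp (h r x) ∂μ)
      (∫ x, h' s x * Real.exp (h s x) ∂μ) s := by
  simpa using hasDerivAt_integral_mul_exp hK hμ (f := fun _ _ => 1) (f' := fun _ _ => 0)
    (by fun_prop) (by fun_prop) hh hh' (fun s _ => hasDerivAt_const s 1) dh s

lemma hasDerivAt_log_integral_exp (hK : IsCompact K) (hμ : ∀ᵐ x ∂μ, x ∈ K)
    {h h' : ℝ → X → ℝ} (hh : Continuous h.uncurry) (hh' : Continuous h'.uncurry)
    (dh : ∀ s x, HasDerivAt (fun r => h r x) (h' s x) s) (s : ℝ) :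
    HasDerivAt (fun r => Real.log (∫ x, Real.exp (h r x) ∂μ)) (gibbsMean μ (h' s) (h s)) s :=
  (hasDerivAt_integral_exp hK hμ hh hh' dh s).log
    (integral_exp_pos_of_continuous hK hμ (hh.comp (Continuous.prodMk_right s))).ne'

lemma hasDerivAt_gibbsMean (hK : IsCompact K) (hμ : ∀ᵐ x ∂μ, x ∈ K)
    {f f' h h' : ℝ → X → ℝ} (hf : Continuous f.uncurry) (hf' : Continuous f'.uncurry)
    (hh : Continuous h.uncurry) (hh' : Continuous h'.uncurry)
    (df : ∀ s x, HasDerivAt (fun r => f r x) (f' s x) s)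
    (dh : ∀ s x, HasDerivAt (fun r => h r x) (h' s x) s) (s : ℝ) :
    HasDerivAt (fun r => gibbsMean μ (f r) (h r))
      (gibbsMean μ (f' s) (h s) + gibbsMean μ (fun x => f s x * h' s x) (h s)
        - gibbsMean μ (f s) (h s) * gibbsMean μ (h' s) (h s)) s := by
  have hs : Continuous (h s) := hh.comp (Continuous.prodMk_right s)
  have hfs : Continuous (f s) := hf.comp (Continuous.prodMk_right s)
  have hfs' : Continuous (f' s) := hf'.comp (Continuous.prodMk_right s)
  have hhs' : Continuous (h' s) := hh'.comp (Continuous.prodMk_right s)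
  have hpos := integral_exp_pos_of_continuous hK hμ hs
  convert! (hasDerivAt_integral_mul_exp hK hμ hf hf' hh hh' df dh s).div
    (hasDerivAt_integral_exp hK hμ hh hh' dh s) hpos.ne' using 1
  rw [← gibbsMean_add hK hμ (g := fun x => f s x * h' s x) hfs' (by fun_prop) hs]
  simp only [gibbsMean]
  field_simp

variable {Ω : Type*} [TopologicalSpace Ω] [FirstCountableTopology Ω] [LocallyCompactSpace Ω]

lemma continuous_integral_of_ae_mem_compact (hK : IsCompact K) (hμ : ∀ᵐ x ∂μ, x ∈ K)
    {f : Ω → X → ℝ} (hf : Continuous f.uncurry) : Continuous fun ω => ∫ x, f ω x ∂μ := by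
  rw [← Measure.restrict_eq_self_of_ae_mem hμ]
  exact continuous_parametric_integral_of_continuous hf hK

lemma continuous_log_integral_exp (hK : IsCompact K) (hμ : ∀ᵐ x ∂μ, x ∈ K)
    {h : Ω → X → ℝ} (hh : Continuous h.uncurry) :
    Continuous fun ω => Real.log (∫ x, Real.exp (h ω x) ∂μ) :=
  (continuous_integral_of_ae_mem_compact hK hμ (f := fun ω x => Real.exp (h ω x))
    (Real.continuous_exp.comp hh)).log fun ω =>
      (integral_exp_pos_of_continuous hK hμ (hh.comp (Continuous.prodMk_right ω))).ne'

lemma continuous_gibbsMean (hK : IsCompact K) (hμ : ∀ᵐ x ∂μ, x ∈ K)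
    {f h : Ω → X → ℝ} (hf : Continuous f.uncurry) (hh : Continuous h.uncurry) :
    Continuous fun ω => gibbsMean μ (f ω) (h ω) :=
  (continuous_integral_of_ae_mem_compact hK hμ (f := fun ω x => f ω x * Real.exp (h ω x))
    (hf.mul (Real.continuous_exp.comp hh))).div
  (continuous_integral_of_ae_mem_compact hK hμ (f := fun ω x => Real.exp (h ω x))
    (Real.continuous_exp.comp hh)) fun ω =>
      (integral_exp_pos_of_continuous hK hμ (hh.comp (Continuous.prodMk_right ω))).ne'

variable [MeasurableSpace Ω] [OpensMeasurableSpace Ω] {ℙ : Measure Ω}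

lemma memLp_gibbsMean (hK : IsCompact K) (hμ : ∀ᵐ x ∂μ, x ∈ K)
    {f h : Ω → X → ℝ} (hf : Continuous f.uncurry) (hh : Continuous h.uncurry) {b : Ω → ℝ}
    {p : ENNReal} (hb : MemLp b p ℙ) (hfb : ∀ᵐ ω ∂ℙ, ∀ x ∈ K, |f ω x| ≤ b ω) :
    MemLp (fun ω => gibbsMean μ (f ω) (h ω)) p ℙ :=
  hb.mono' (continuous_gibbsMean hK hμ hf hh).aestronglyMeasurable <| hfb.mono fun ω hω =>
    abs_gibbsMean_le hK hμ (hf.comp (Continuous.prodMk_right ω))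
      (hh.comp (Continuous.prodMk_right ω)) hω

lemma integrable_gibbsMean (hK : IsCompact K) (hμ : ∀ᵐ x ∂μ, x ∈ K)
    {f h : Ω → X → ℝ} (hf : Continuous f.uncurry) (hh : Continuous h.uncurry) {b : Ω → ℝ}
    (hb : Integrable b ℙ) (hfb : ∀ᵐ ω ∂ℙ, ∀ x ∈ K, |f ω x| ≤ b ω) :
    Integrable (fun ω => gibbsMean μ (f ω) (h ω)) ℙ :=
  memLp_one_iff_integrable.1
    (memLp_gibbsMean hK hμ hf hh (memLp_one_iff_integrable.2 hb) hfb)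

lemma integrable_gibbsMean_sq (hK : IsCompact K) (hμ : ∀ᵐ x ∂μ, x ∈ K)
    {f h : Ω → X → ℝ} (hf : Continuous f.uncurry) (hh : Continuous h.uncurry) {b : Ω → ℝ}
    (hb : MemLp b 2 ℙ) (hfb : ∀ᵐ ω ∂ℙ, ∀ x ∈ K, |f ω x| ≤ b ω) :
    Integrable (fun ω => gibbsMean μ (fun x => f ω x ^ 2) (h ω)) ℙ :=
  integrable_gibbsMean hK hμ (hf.pow 2) hh hb.integrable_sq <| hfb.mono fun ω hω x hx => by
    rw [abs_pow]
    exact pow_le_pow_left₀ (abs_nonneg _) (hω x hx) 2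

section FreeEnergy

variable {A B C : Ω → X → ℝ} {W : Ω → ℝ}

lemma integrable_log_partition (hK : IsCompact K) (hμ : ∀ᵐ x ∂μ, x ∈ K)
    (hA : Continuous A.uncurry)
    (hB : Continuous B.uncurry) (hC : Continuous C.uncurry) (hW : Integrable W ℙ)
    (hAW : ∀ᵐ ω ∂ℙ, ∀ x ∈ K, |A ω x| ≤ W ω) (hBW : ∀ᵐ ω ∂ℙ, ∀ x ∈ K, |B ω x| ≤ W ω)
    (hCW : ∀ᵐ ω ∂ℙ, ∀ x ∈ K, |C ω x| ≤ W ω) (s : ℝ) :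
    Integrable (fun ω =>
      Real.log (∫ x, Real.exp (A ω x + s ^ 2 * B ω x + s * C ω x) ∂μ)) ℙ := by
  have hhs : Continuous (Function.uncurry fun ω x => A ω x + s ^ 2 * B ω x + s * C ω x) :=
    (continuous_tilt hA hB hC).comp (f := fun p : Ω × X => ((s, p.1), p.2)) (by fun_prop)
  refine (hW.const_mul (1 + s ^ 2 + |s|)).mono'
    (continuous_log_integral_exp hK hμ hhs).aestronglyMeasurable ?_
  filter_upwards [hAW, hBW, hCW] with ω ha hb hc
  refine abs_log_integral_exp_le hK hμ (hhs.comp (Continuous.prodMk_right ω)) fun x hx => ?_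
  calc |A ω x + s ^ 2 * B ω x + s * C ω x|
      ≤ |A ω x| + |s ^ 2 * B ω x| + |s * C ω x| := abs_add_three _ _ _
    _ = |A ω x| + s ^ 2 * |B ω x| + |s| * |C ω x| := by
        rw [abs_mul, abs_mul, abs_of_nonneg (sq_nonneg s)]
    _ ≤ W ω + s ^ 2 * W ω + |s| * W ω := by
        gcongr
        exacts [ha x hx, hb x hx, hc x hx]
    _ = _ := by ring

lemma hasDerivAt_integral_log_partition [IsProbabilityMeasure ℙ]
    (hK : IsCompact K) (hμ : ∀ᵐ x ∂μ, x ∈ K) (hA : Continuous A.uncurry)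
    (hB : Continuous B.uncurry) (hC : Continuous C.uncurry) (hW : MemLp W 2 ℙ)
    (hAW : ∀ᵐ ω ∂ℙ, ∀ x ∈ K, |A ω x| ≤ W ω) (hBW : ∀ᵐ ω ∂ℙ, ∀ x ∈ K, |B ω x| ≤ W ω)
    (hCW : ∀ᵐ ω ∂ℙ, ∀ x ∈ K, |C ω x| ≤ W ω) (s : ℝ) :
    HasDerivAt
      (fun r => ∫ ω, Real.log (∫ x, Real.exp (A ω x + r ^ 2 * B ω x + r * C ω x) ∂μ) ∂ℙ)
      (∫ ω, gibbsMean μ (fun x => 2 * s * B ω x + C ω x)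
        (fun x => A ω x + s ^ 2 * B ω x + s * C ω x) ∂ℙ) s := by
  have hW1 : Integrable W ℙ := hW.integrable one_le_two
  have hh := continuous_tilt hA hB hC
  have hg := continuous_tilt_deriv hB hC
  have hhr (r : ℝ) : Continuous (Function.uncurry fun ω x =>
      A ω x + r ^ 2 * B ω x + r * C ω x) :=
    hh.comp (f := fun p : Ω × X => ((r, p.1), p.2)) (by fun_prop)
  have hgr (r : ℝ) : Continuous (Function.uncurry fun ω x => 2 * r * B ω x + C ω x) :=
    hg.comp (f := fun p : Ω × X => ((r, p.1), p.2)) (by fun_prop)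
  have hhω (ω : Ω) : Continuous (Function.uncurry fun r x =>
      A ω x + r ^ 2 * B ω x + r * C ω x) :=
    hh.comp (f := fun p : ℝ × X => ((p.1, ω), p.2)) (by fun_prop)
  have hgω (ω : Ω) : Continuous (Function.uncurry fun r x => 2 * r * B ω x + C ω x) :=
    hg.comp (f := fun p : ℝ × X => ((p.1, ω), p.2)) (by fun_prop)
  refine (hasDerivAt_integral_of_dominated_loc_of_deriv_le
    (F := fun r ω => Real.log (∫ x, Real.exp (A ω x + r ^ 2 * B ω x + r * C ω x) ∂μ))
    (F' := fun r ω => gibbsMean μ (fun x => 2 * r * B ω x + C ω x)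
        (fun x => A ω x + r ^ 2 * B ω x + r * C ω x))
    (bound := fun ω => (2 * (|s| + 1) + 1) * W ω)
    (Metric.closedBall_mem_nhds s one_pos) (Eventually.of_forall fun r => ?_) ?_ ?_
    ?_ (hW1.const_mul _) (Eventually.of_forall fun ω r _ => ?_)).2
  · exact (continuous_log_integral_exp hK hμ (hhr r)).aestronglyMeasurable
  · exact integrable_log_partition hK hμ hA hB hC hW1 hAW hBW hCW s
  · exact (continuous_gibbsMean hK hμ (hgr s) (hhr s)).aestronglyMeasurable
  · filter_upwards [hBW, hCW] with ω hb hc r hr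
    refine abs_gibbsMean_le hK hμ ((hgr r).comp (Continuous.prodMk_right ω))
      ((hhr r).comp (Continuous.prodMk_right ω)) fun x hx => ?_
    exact abs_tilt_deriv_le (abs_le_of_mem_closedBall_one hr) (hb x hx) (hc x hx)
  · refine hasDerivAt_log_integral_exp hK hμ (hhω ω) (hgω ω) (fun r x => ?_) r
    convert! ((((hasDerivAt_id r).pow 2).mul_const (B ω x)).const_add (A ω x)).add
      ((hasDerivAt_id r).mul_const (C ω x)) using 1
    simp

lemma hasDerivAt_integral_gibbsMean [IsProbabilityMeasure ℙ]
    (hK : IsCompact K) (hμ : ∀ᵐ x ∂μ, x ∈ K) (hA : Continuous A.uncurry)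
    (hB : Continuous B.uncurry) (hC : Continuous C.uncurry) (hW : MemLp W 2 ℙ)
    (hBW : ∀ᵐ ω ∂ℙ, ∀ x ∈ K, |B ω x| ≤ W ω)
    (hCW : ∀ᵐ ω ∂ℙ, ∀ x ∈ K, |C ω x| ≤ W ω) (s : ℝ) :
    HasDerivAt
      (fun r => ∫ ω, gibbsMean μ (fun x => 2 * r * B ω x + C ω x)
        (fun x => A ω x + r ^ 2 * B ω x + r * C ω x) ∂ℙ)
      (∫ ω, (gibbsMean μ (fun x => 2 * B ω x)
          (fun x => A ω x + s ^ 2 * B ω x + s * C ω x)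
        + gibbsMean μ (fun x => (2 * s * B ω x + C ω x) ^ 2)
          (fun x => A ω x + s ^ 2 * B ω x + s * C ω x)
        - gibbsMean μ (fun x => 2 * s * B ω x + C ω x)
          (fun x => A ω x + s ^ 2 * B ω x + s * C ω x) ^ 2) ∂ℙ) s := by
  have hW1 : Integrable W ℙ := hW.integrable one_le_two
  have hW2 : Integrable (fun ω => W ω ^ 2) ℙ := hW.integrable_sq
  have hh := continuous_tilt hA hB hC
  have hg := continuous_tilt_deriv hB hC
  have hhr (r : ℝ) : Continuous (Function.uncurry fun ω x =>
      A ω x + r ^ 2 * B ω x + r * C ω x) :=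
    hh.comp (f := fun p : Ω × X => ((r, p.1), p.2)) (by fun_prop)
  have hgr (r : ℝ) : Continuous (Function.uncurry fun ω x => 2 * r * B ω x + C ω x) :=
    hg.comp (f := fun p : Ω × X => ((r, p.1), p.2)) (by fun_prop)
  have hhω (ω : Ω) : Continuous (Function.uncurry fun r x =>
      A ω x + r ^ 2 * B ω x + r * C ω x) :=
    hh.comp (f := fun p : ℝ × X => ((p.1, ω), p.2)) (by fun_prop)
  have hgω (ω : Ω) : Continuous (Function.uncurry fun r x => 2 * r * B ω x + C ω x) :=
    hg.comp (f := fun p : ℝ × X => ((p.1, ω), p.2)) (by fun_prop)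
  have hB2 : Continuous (Function.uncurry fun ω x => 2 * B ω x) :=
    continuous_const.mul hB
  have hg2 (r : ℝ) : Continuous (Function.uncurry fun ω x => (2 * r * B ω x + C ω x) ^ 2) := by
    have := hgr r
    simp only [Function.uncurry_def] at this ⊢
    fun_prop
  have hgW (r : ℝ) : ∀ᵐ ω ∂ℙ, ∀ x ∈ K, |2 * r * B ω x + C ω x| ≤ (2 * |r| + 1) * W ω := by
    filter_upwards [hBW, hCW] with ω hb hc x hx
    exact abs_tilt_deriv_le le_rfl (hb x hx) (hc x hx)
  have hmeas (r : ℝ) := (((continuous_gibbsMean hK hμ hB2 (hhr r)).add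
      (continuous_gibbsMean hK hμ (hg2 r) (hhr r))).sub
      ((continuous_gibbsMean hK hμ (hgr r) (hhr r)).pow 2)).aestronglyMeasurable (μ := ℙ)
  refine (hasDerivAt_integral_of_dominated_loc_of_deriv_le
    (F := fun r ω => gibbsMean μ (fun x => 2 * r * B ω x + C ω x)
        (fun x => A ω x + r ^ 2 * B ω x + r * C ω x))
    (F' := fun r ω => gibbsMean μ (fun x => 2 * B ω x)
          (fun x => A ω x + r ^ 2 * B ω x + r * C ω x)
        + gibbsMean μ (fun x => (2 * r * B ω x + C ω x) ^ 2)
          (fun x => A ω x + r ^ 2 * B ω x + r * C ω x)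
        - gibbsMean μ (fun x => 2 * r * B ω x + C ω x)
          (fun x => A ω x + r ^ 2 * B ω x + r * C ω x) ^ 2)
    (bound := fun ω => 2 * W ω + 2 * (2 * (|s| + 1) + 1) ^ 2 * W ω ^ 2)
    (Metric.closedBall_mem_nhds s one_pos) (Eventually.of_forall fun r => ?_) ?_ (hmeas s)
    ?_ ((hW1.const_mul _).add (hW2.const_mul _)) (Eventually.of_forall fun ω r _ => ?_)).2
  · exact (continuous_gibbsMean hK hμ (hgr r) (hhr r)).aestronglyMeasurable
  · exact integrable_gibbsMean hK hμ (hgr s) (hhr s) (hW1.const_mul _) (hgW s)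
  · filter_upwards [hBW, hCW] with ω hb hc r hr
    have hcω := (hhr r).comp (Continuous.prodMk_right ω)
    have hgω' := (hgr r).comp (Continuous.prodMk_right ω)
    have hL : ∀ x ∈ K, |2 * r * B ω x + C ω x| ≤ (2 * (|s| + 1) + 1) * W ω := fun x hx =>
      abs_tilt_deriv_le (abs_le_of_mem_closedBall_one hr) (hb x hx) (hc x hx)
    have h1 := abs_gibbsMean_le hK hμ (hB2.comp (Continuous.prodMk_right ω)) hcω
      (M := 2 * W ω) fun x hx => by
        simpa [abs_mul] using hb x hx
    have h2 := abs_gibbsMean_le hK hμ ((hg2 r).comp (Continuous.prodMk_right ω)) hcω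
      (M := ((2 * (|s| + 1) + 1) * W ω) ^ 2) fun x hx => by
        simp only [Function.comp_apply, Function.uncurry_apply_pair, abs_pow]
        exact pow_le_pow_left₀ (abs_nonneg _) (hL x hx) 2
    have h3 := pow_le_pow_left₀ (abs_nonneg _) (abs_gibbsMean_le hK hμ hgω' hcω hL) 2
    rw [← abs_pow] at h3
    refine (abs_sub _ _).trans ?_
    refine (add_le_add ((abs_add_le _ _).trans (add_le_add h1 h2)) h3).trans (le_of_eq ?_)
    ring
  · have key := hasDerivAt_gibbsMean hK hμ (hgω ω)
      (f' := fun _ x => 2 * B ω x) (hB2.comp (f := fun p : ℝ × X => (ω, p.2)) (by fun_prop))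
      (hhω ω) (hgω ω)
      (fun r x => by
        simpa using (((hasDerivAt_id r).const_mul 2).mul_const (B ω x)).add_const (C ω x))
      (fun r x => by
        convert! ((((hasDerivAt_id r).pow 2).mul_const (B ω x)).const_add (A ω x)).add
          ((hasDerivAt_id r).mul_const (C ω x)) using 1
        simp) r
    simpa only [sq] using key

end FreeEnergy

end GibbsMean

section Gaussian

open ProbabilityTheory hiding stdGaussian

lemma hasDerivAt_gaussianPDFReal_zero_one (x : ℝ) :
    HasDerivAt (gaussianPDFReal 0 1) (-(x * gaussianPDFReal 0 1 x)) x := by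
  have h : HasDerivAt (fun y : ℝ => -(y - 0) ^ 2 / (2 * ((1 : NNReal) : ℝ))) (-x) x := by
    convert! ((((hasDerivAt_id x).sub_const 0).pow 2).neg.div_const
      (2 * ((1 : NNReal) : ℝ))) using 1
    simp
    ring
  convert! h.exp.const_mul ((√(2 * π * ((1 : NNReal) : ℝ)))⁻¹) using 1
  rw [gaussianPDFReal]
  ring

lemma integrable_gaussianReal_iff {f : ℝ → ℝ} :
    Integrable f (gaussianReal 0 1) ↔ Integrable fun x => gaussianPDFReal 0 1 x * f x := by
  rw [gaussianReal_of_var_ne_zero _ one_ne_zero,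
    integrable_withDensity_iff_integrable_smul' (measurable_gaussianPDF 0 1)
      (Eventually.of_forall fun _ => gaussianPDF_lt_top)]
  simp [toReal_gaussianPDF]

lemma integrable_id_gaussianReal : Integrable (fun x : ℝ => x) (gaussianReal 0 1) :=
  (memLp_id_gaussianReal 1).integrable (by simp)

/-- Gaussian integration by parts (Stein's lemma) for bounded functions. -/
lemma integral_id_mul_gaussianReal {G G' : ℝ → ℝ} (hG : ∀ x, HasDerivAt G (G' x) x)
    (hG' : Continuous G') {M M' : ℝ} (hM : ∀ x, |G x| ≤ M) (hM' : ∀ x, |G' x| ≤ M') :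
    ∫ x, x * G x ∂(gaussianReal 0 1) = ∫ x, G' x ∂(gaussianReal 0 1) := by
  have hGc : Continuous G := continuous_iff_continuousAt.2 fun x => (hG x).continuousAt
  have i0 : Integrable G (gaussianReal 0 1) :=
    Integrable.of_bound hGc.aestronglyMeasurable M (Eventually.of_forall hM)
  have i1 : Integrable G' (gaussianReal 0 1) :=
    Integrable.of_bound hG'.aestronglyMeasurable M' (Eventually.of_forall hM')
  have i2 : Integrable (fun x => x * G x) (gaussianReal 0 1) :=
    integrable_id_gaussianReal.mul_bdd hGc.aestronglyMeasurable (Eventually.of_forall hM)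
  rw [integrable_gaussianReal_iff] at i0 i1 i2
  have key := integral_mul_deriv_eq_deriv_mul_of_integrable (u := G) (u' := G')
    (v := gaussianPDFReal 0 1) (v' := fun x => -(x * gaussianPDFReal 0 1 x))
    (fun x _ => hG x) (fun x _ => hasDerivAt_gaussianPDFReal_zero_one x)
    (i2.neg.congr (Eventually.of_forall fun x => by simp; ring))
    (i1.congr (Eventually.of_forall fun x => by simp; ring))
    (i0.congr (Eventually.of_forall fun x => by simp; ring))
  rw [integral_gaussianReal_eq_integral_smul one_ne_zero,
    integral_gaussianReal_eq_integral_smul one_ne_zero]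
  simp only [smul_eq_mul]
  calc ∫ x, gaussianPDFReal 0 1 x * (x * G x)
      = -∫ x, G x * -(x * gaussianPDFReal 0 1 x) := by
        rw [← integral_neg]; congr 1; ext x; ring
    _ = ∫ x, gaussianPDFReal 0 1 x * G' x := by
        rw [key, neg_neg]; congr 1; ext x; ring

instance (m : ℕ) : IsProbabilityMeasure (stdGaussian m) := by
  unfold stdGaussian; infer_instance

instance (p q : ℕ) : IsProbabilityMeasure (stdGaussianMat p q) := by
  unfold stdGaussianMat; infer_instance

lemma memLp_eval_stdGaussian {m : ℕ} (j : Fin m) :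
    MemLp (fun z : Fin m → ℝ => z j) 2 (stdGaussian m) :=
  (memLp_id_gaussianReal 2).comp_measurePreserving
    (measurePreserving_eval (fun _ : Fin m => gaussianReal 0 1) j)

lemma memLp_eval_stdGaussianMat {p q : ℕ} (i : Fin p) (j : Fin q) :
    MemLp (fun z : Fin p → Fin q → ℝ => z i j) 2 (stdGaussianMat p q) :=
  (memLp_eval_stdGaussian j).comp_measurePreserving
    (measurePreserving_eval (fun _ : Fin p => stdGaussian q) i)

/-- Gaussian integration by parts in the `j`-th coordinate. -/
lemma integral_eval_mul_stdGaussian {m : ℕ} (j : Fin (m + 1)) {F F' : (Fin (m + 1) → ℝ) → ℝ}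
    (hF : ∀ (w : Fin m → ℝ) (x : ℝ), HasDerivAt (fun y => F (j.insertNth (α := fun _ => ℝ) y w))
      (F' (j.insertNth (α := fun _ => ℝ) x w)) x)
    (cF : Continuous F) (cF' : Continuous F') {M M' : ℝ} (hM : ∀ z, |F z| ≤ M)
    (hM' : ∀ z, |F' z| ≤ M') :
    ∫ z, z j * F z ∂(stdGaussian (m + 1)) = ∫ z, F' z ∂(stdGaussian (m + 1)) := by
  have i1 : Integrable F' (stdGaussian (m + 1)) :=
    Integrable.of_bound cF'.aestronglyMeasurable M' (Eventually.of_forall hM')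
  have i2 : Integrable (fun z => z j * F z) (stdGaussian (m + 1)) :=
    ((memLp_eval_stdGaussian j).integrable one_le_two).mul_bdd cF.aestronglyMeasurable
      (Eventually.of_forall hM)
  have hmp := (measurePreserving_piFinSuccAbove
    (fun _ : Fin (m + 1) => gaussianReal 0 1) j).symm
  have hemb := (MeasurableEquiv.piFinSuccAbove (fun _ : Fin (m + 1) => ℝ) j).symm.measurableEmbedding
  have split {f : (Fin (m + 1) → ℝ) → ℝ} (hf : Integrable f (stdGaussian (m + 1))) :
      ∫ z, f z ∂(stdGaussian (m + 1)) = ∫ w, ∫ x, f (j.insertNth (α := fun _ => ℝ) x w)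
        ∂(gaussianReal 0 1) ∂(stdGaussian m) := by
    rw [stdGaussian, ← hmp.integral_comp hemb, integral_prod_symm]
    · rfl
    · exact (hmp.integrable_comp_emb hemb).2 hf
  rw [split i2, split i1]
  congr 1
  ext w
  have hins : Continuous fun x : ℝ => j.insertNth (α := fun _ => ℝ) x w := by fun_prop
  simpa using integral_id_mul_gaussianReal (hF w) (cF'.comp hins) (fun x => hM _)
    (fun x => hM' _)

end Gaussian

section GibbsStein

variable {X : Type*} [MeasurableSpace X] [TopologicalSpace X] [OpensMeasurableSpace X]
  {μ : Measure X} [IsProbabilityMeasure μ] {K : Set X}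

lemma integral_sum_gibbsMean_mul_eval {m : ℕ} (hK : IsCompact K) (hμ : ∀ᵐ x ∂μ, x ∈ K)
    {a : X → ℝ} (ha : Continuous a) (c : ℝ) {v : X → Fin m → ℝ} (hv : Continuous v) :
    ∫ z, ∑ j, gibbsMean μ (fun x => v x j) (fun x => a x + c * ∑ k, v x k * z k) * z j
        ∂(stdGaussian m)
      = ∫ z, c * ((∑ j, gibbsMean μ (fun x => v x j ^ 2) (fun x => a x + c * ∑ k, v x k * z k))
          - ∑ j, gibbsMean μ (fun x => v x j) (fun x => a x + c * ∑ k, v x k * z k) ^ 2)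
        ∂(stdGaussian m) := by
  have hvk (k : Fin m) : Continuous fun x => v x k := (continuous_apply k).comp hv
  have hh : Continuous (Function.uncurry fun (z : Fin m → ℝ) x =>
      a x + c * ∑ k, v x k * z k) := by
    simp only [Function.uncurry_def]
    fun_prop
  have c1 (j : Fin m) : Continuous fun z : Fin m → ℝ => gibbsMean μ (fun x => v x j)
      (fun x => a x + c * ∑ k, v x k * z k) :=
    continuous_gibbsMean hK hμ (f := fun _ x => v x j) ((hvk j).comp continuous_snd) hh
  have c2 (j : Fin m) : Continuous fun z : Fin m → ℝ => gibbsMean μ (fun x => v x j ^ 2)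
      (fun x => a x + c * ∑ k, v x k * z k) :=
    continuous_gibbsMean hK hμ (f := fun _ x => v x j ^ 2)
      (((hvk j).pow 2).comp continuous_snd) hh
  have c3 (j : Fin m) : Continuous fun z : Fin m → ℝ =>
      c * (gibbsMean μ (fun x => v x j ^ 2) (fun x => a x + c * ∑ k, v x k * z k)
        - gibbsMean μ (fun x => v x j) (fun x => a x + c * ∑ k, v x k * z k) ^ 2) :=
    continuous_const.mul ((c2 j).sub ((c1 j).pow 2))
  have hhz (z : Fin m → ℝ) : Continuous fun x => a x + c * ∑ k, v x k * z k := by fun_prop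
  have bound (j : Fin m) : ∃ M : ℝ, ∀ x ∈ K, |v x j| ≤ M :=
    hK.exists_bound_of_continuousOn (hvk j).continuousOn
  choose M hM using bound
  have b1 (j : Fin m) (z : Fin m → ℝ) := abs_gibbsMean_le hK hμ (hvk j) (hhz z) (hM j)
  have b2 (j : Fin m) (z : Fin m → ℝ) := abs_gibbsMean_le hK hμ (f := fun x => v x j ^ 2)
    ((hvk j).pow 2) (hhz z) (M := M j ^ 2) fun x hx => by
      rw [abs_pow]; exact pow_le_pow_left₀ (abs_nonneg _) (hM j x hx) 2
  have b3 (j : Fin m) (z : Fin m → ℝ) := pow_le_pow_left₀ (abs_nonneg _) (b1 j z) 2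
  have bd (j : Fin m) (z : Fin m → ℝ) :
      |c * (gibbsMean μ (fun x => v x j ^ 2) (fun x => a x + c * ∑ k, v x k * z k)
        - gibbsMean μ (fun x => v x j) (fun x => a x + c * ∑ k, v x k * z k) ^ 2)|
      ≤ |c| * (M j ^ 2 + M j ^ 2) := by
    rw [abs_mul]
    refine mul_le_mul_of_nonneg_left ((abs_sub _ _).trans ?_) (abs_nonneg c)
    rw [abs_pow]
    exact add_le_add (b2 j z) (b3 j z)
  have i1 (j : Fin m) : Integrable (fun z => gibbsMean μ (fun x => v x j)
      (fun x => a x + c * ∑ k, v x k * z k) * z j) (stdGaussian m) :=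
    ((memLp_eval_stdGaussian j).integrable one_le_two).bdd_mul (c1 j).aestronglyMeasurable
      (Eventually.of_forall (b1 j))
  have i2 (j : Fin m) : Integrable (fun z =>
      c * (gibbsMean μ (fun x => v x j ^ 2) (fun x => a x + c * ∑ k, v x k * z k)
        - gibbsMean μ (fun x => v x j) (fun x => a x + c * ∑ k, v x k * z k) ^ 2))
      (stdGaussian m) :=
    Integrable.of_bound (c3 j).aestronglyMeasurable _ (Eventually.of_forall (bd j))
  rw [integral_finsetSum _ fun j _ => i1 j]
  refine Eq.trans (Finset.sum_congr rfl fun j _ => ?_)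
    ((integral_finsetSum _ fun j _ => i2 j).symm.trans (integral_congr_ae
      (Eventually.of_forall fun z => by
        dsimp only; rw [← Finset.sum_sub_distrib, Finset.mul_sum])))
  obtain _ | m := m
  · exact j.elim0
  rw [← integral_eval_mul_stdGaussian j (F := fun z => gibbsMean μ (fun x => v x j)
      (fun x => a x + c * ∑ k, v x k * z k))
    (F' := fun z => c * (gibbsMean μ (fun x => v x j ^ 2) (fun x => a x + c * ∑ k, v x k * z k)
        - gibbsMean μ (fun x => v x j) (fun x => a x + c * ∑ k, v x k * z k) ^ 2))
    (fun w y => ?_) (c1 j) (c3 j) (b1 j) (bd j)]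
  · exact integral_congr_ae (Eventually.of_forall fun z => mul_comm _ _)
  have key := hasDerivAt_gibbsMean hK hμ (f := fun _ x => v x j) (f' := fun _ _ => 0)
    (h := fun y x => a x + c * ∑ k, v x k * j.insertNth (α := fun _ => ℝ) y w k)
    (h' := fun _ x => c * v x j)
    (by simp only [Function.uncurry_def]; fun_prop)
    (by fun_prop)
    (hh.comp (f := fun p : ℝ × X => (j.insertNth (α := fun _ => ℝ) p.1 w, p.2)) (by fun_prop))
    (by simp only [Function.uncurry_def]; fun_prop)
    (fun y x => hasDerivAt_const y _)
    (fun y x => by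
      simp only [Fin.sum_univ_succAbove _ j, Fin.insertNth_apply_same,
        Fin.insertNth_apply_succAbove]
      simpa using ((((hasDerivAt_id y).const_mul (v x j)).add_const
        (∑ i, v x (j.succAbove i) * w i)).const_mul c).const_add (a x)) y
  convert! key using 1
  have e1 : (fun x => v x j * (c * v x j)) = fun x => c * v x j ^ 2 := by ext x; ring
  have e2 : gibbsMean μ (fun _ => 0)
      (fun x => a x + c * ∑ k, v x k * j.insertNth (α := fun _ => ℝ) y w k) = 0 := by
    simp [gibbsMean]
  simp only [e1, e2, gibbsMean_const_mul]
  ring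

end GibbsStein

section Sphere

/-- The Euclidean sphere of radius `|r|` in `Fin m → ℝ`. -/
def euclSphere (m : ℕ) (r : ℝ) : Set (Fin m → ℝ) := {x | ∑ i, x i ^ 2 = r ^ 2}

lemma abs_apply_le_of_mem_euclSphere {m : ℕ} {r : ℝ} {x : Fin m → ℝ}
    (hx : x ∈ euclSphere m r) (i : Fin m) : |x i| ≤ |r| := by
  rw [← sq_le_sq, ← show ∑ i, x i ^ 2 = r ^ 2 from hx]
  exact Finset.single_le_sum (f := fun i => x i ^ 2) (fun i _ => sq_nonneg _) (Finset.mem_univ i)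

lemma isCompact_euclSphere (m : ℕ) (r : ℝ) : IsCompact (euclSphere m r) := by
  refine (isCompact_closedBall (0 : Fin m → ℝ) |r|).of_isClosed_subset
    (isClosed_eq (by fun_prop) continuous_const) fun x hx => ?_
  rw [mem_closedBall_zero_iff, pi_norm_le_iff_of_nonneg (abs_nonneg r)]
  exact abs_apply_le_of_mem_euclSphere hx

end Sphere

section Disorder

/-- The disorder `(U, V, Z, Z̃, Z̄)`. -/
abbrev Disorder (nu nv : ℕ) : Type :=
  (Fin nu → ℝ) × (Fin nv → ℝ) × (Fin nu → Fin nv → ℝ) × (Fin nu → ℝ) × (Fin nv → ℝ)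

/-- The joint law of the disorder. -/
def disorderLaw {nu nv : ℕ} (Pu : Measure (Fin nu → ℝ)) (Pv : Measure (Fin nv → ℝ)) :
    Measure (Disorder nu nv) :=
  Pu.prod (Pv.prod ((stdGaussianMat nu nv).prod ((stdGaussian nu).prod (stdGaussian nv))))

lemma ae_mem_of_ae_disorderLaw {nu nv : ℕ} {Pu : Measure (Fin nu → ℝ)}
    {Pv : Measure (Fin nv → ℝ)}
    {Su : Set (Fin nu → ℝ)} {Sv : Set (Fin nv → ℝ)}
    (hu : ∀ᵐ x ∂Pu, x ∈ Su) (hv : ∀ᵐ x ∂Pv, x ∈ Sv) :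
    ∀ᵐ ω ∂(disorderLaw Pu Pv), ω.1 ∈ Su ∧ ω.2.1 ∈ Sv :=
  (Measure.quasiMeasurePreserving_fst.ae hu).and
    (Measure.quasiMeasurePreserving_snd.ae (Measure.quasiMeasurePreserving_fst.ae hv))

variable {nu nv : ℕ} {Pu : Measure (Fin nu → ℝ)} {Pv : Measure (Fin nv → ℝ)}
  [IsProbabilityMeasure Pu] [IsProbabilityMeasure Pv]

instance : IsProbabilityMeasure (disorderLaw Pu Pv) := by
  unfold disorderLaw; infer_instance

lemma Efull_eq_integral {f : (Fin nu → ℝ) → (Fin nv → ℝ) → (Fin nu → Fin nv → ℝ) →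
      (Fin nu → ℝ) → (Fin nv → ℝ) → ℝ} {g : Disorder nu nv → ℝ}
    (hfg : ∀ U V Z Zt Zb, f U V Z Zt Zb = g (U, V, Z, Zt, Zb))
    (hg : Integrable g (disorderLaw Pu Pv)) :
    Efull nu nv Pu Pv f = ∫ ω, g ω ∂(disorderLaw Pu Pv) := by
  unfold disorderLaw at hg ⊢
  simp only [Efull, hfg]
  rw [integral_prod _ hg]
  refine integral_congr_ae (hg.prod_right_ae.mono fun U hU => ?_)
  dsimp only at hU ⊢
  rw [integral_prod _ hU]
  refine integral_congr_ae (hU.prod_right_ae.mono fun V hV => ?_)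
  dsimp only at hV ⊢
  rw [integral_prod _ hV]
  refine integral_congr_ae (hV.prod_right_ae.mono fun Z hZ => ?_)
  dsimp only at hZ ⊢
  rw [integral_prod _ hZ]

/-- One plus the `ℓ¹` norm of the noise. -/
def noiseSize (ω : Disorder nu nv) : ℝ :=
  1 + ∑ i, ∑ j, |ω.2.2.1 i j| + ∑ i, |ω.2.2.2.1 i| + ∑ j, |ω.2.2.2.2 j|

lemma memLp_noiseSize : MemLp noiseSize 2 (disorderLaw Pu Pv) := by
  have hN : MeasurePreserving (fun ω : Disorder nu nv => ω.2.2) (disorderLaw Pu Pv)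
      ((stdGaussianMat nu nv).prod ((stdGaussian nu).prod (stdGaussian nv))) :=
    measurePreserving_snd.comp measurePreserving_snd
  have hZ (i : Fin nu) (j : Fin nv) :
      MemLp (fun ω : Disorder nu nv => |ω.2.2.1 i j|) 2 (disorderLaw Pu Pv) :=
    (memLp_eval_stdGaussianMat i j).abs.comp_measurePreserving (measurePreserving_fst.comp hN)
  have hZt (i : Fin nu) :
      MemLp (fun ω : Disorder nu nv => |ω.2.2.2.1 i|) 2 (disorderLaw Pu Pv) :=
    (memLp_eval_stdGaussian i).abs.comp_measurePreserving
      (measurePreserving_fst.comp (measurePreserving_snd.comp hN))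
  have hZb (j : Fin nv) :
      MemLp (fun ω : Disorder nu nv => |ω.2.2.2.2 j|) 2 (disorderLaw Pu Pv) :=
    (memLp_eval_stdGaussian j).abs.comp_measurePreserving
      (measurePreserving_snd.comp (measurePreserving_snd.comp hN))
  have h1 : MemLp (fun ω : Disorder nu nv => ∑ i, ∑ j, |ω.2.2.1 i j|) 2 (disorderLaw Pu Pv) :=
    memLp_finsetSum _ fun i _ => memLp_finsetSum _ fun j _ => hZ i j
  have h2 : MemLp (fun ω : Disorder nu nv => ∑ i, |ω.2.2.2.1 i|) 2 (disorderLaw Pu Pv) :=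
    memLp_finsetSum _ fun i _ => hZt i
  have h3 : MemLp (fun ω : Disorder nu nv => ∑ j, |ω.2.2.2.2 j|) 2 (disorderLaw Pu Pv) :=
    memLp_finsetSum _ fun j _ => hZb j
  have h0 : MemLp (fun _ : Disorder nu nv => (1 : ℝ)) 2 (disorderLaw Pu Pv) := memLp_const 1
  have h := ((h0.add h1).add h2).add h3
  exact h

end Disorder

section Energy

/-- The part of the Hamiltonian that does not involve `R_u`. -/
def baseEnergy (n nu nv : ℕ) (av t Rv : ℝ) (ω : Disorder nu nv)
    (x : (Fin nu → ℝ) × (Fin nv → ℝ)) : ℝ :=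
  (∑ i, ∑ j, ((1 - t) / (2 * n) * (x.1 i) ^ 2 * (x.2 j) ^ 2
      - Real.sqrt ((1 - t) / n) * x.1 i * x.2 j
          * (Real.sqrt ((1 - t) / n) * ω.1 i * ω.2.1 j + ω.2.2.1 i j)))
  + (∑ i, (av * Rv / 2 * (x.1 i) ^ 2
      - Real.sqrt (av * Rv) * x.1 i * (Real.sqrt (av * Rv) * ω.1 i + ω.2.2.2.1 i)))

/-- The coefficient of `R_u` in `-H`. -/
def signalWeight {nu nv : ℕ} (au : ℝ) (ω : Disorder nu nv) (x : (Fin nu → ℝ) × (Fin nv → ℝ)) :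
    ℝ :=
  ∑ j, (au * x.2 j * ω.2.1 j - au / 2 * (x.2 j) ^ 2)

/-- The coefficient of `√R_u` in `-H`. -/
def noiseWeight {nu nv : ℕ} (au : ℝ) (ω : Disorder nu nv) (x : (Fin nu → ℝ) × (Fin nv → ℝ)) :
    ℝ :=
  Real.sqrt au * ∑ j, x.2 j * ω.2.2.2.2 j

variable {n nu nv : ℕ} {au av t Ru Rv : ℝ}

lemma neg_interpH_eq (hau : 0 ≤ au) (hRu : 0 ≤ Ru) (ω : Disorder nu nv)
    (x : (Fin nu → ℝ) × (Fin nv → ℝ)) :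
    -interpH n nu nv au av t Ru Rv ω.1 ω.2.1 ω.2.2.1 ω.2.2.2.1 ω.2.2.2.2 x.1 x.2
      = -baseEnergy n nu nv av t Rv ω x + Real.sqrt Ru ^ 2 * signalWeight au ω x
        + Real.sqrt Ru * noiseWeight au ω x := by
  have key : ∑ j, (au * Ru / 2 * (x.2 j) ^ 2
      - Real.sqrt (au * Ru) * x.2 j * (Real.sqrt (au * Ru) * ω.2.1 j + ω.2.2.2.2 j))
      = -(Real.sqrt Ru ^ 2 * signalWeight au ω x + Real.sqrt Ru * noiseWeight au ω x) := by
    simp only [signalWeight, noiseWeight, Finset.mul_sum, ← Finset.sum_add_distrib,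
      ← Finset.sum_neg_distrib]
    refine Finset.sum_congr rfl fun j _ => ?_
    rw [Real.sqrt_mul hau]
    linear_combination -Real.sqrt Ru ^ 2 * x.2 j * ω.2.1 j *
      Real.sq_sqrt hau - au / 2 * x.2 j ^ 2 * Real.sq_sqrt hRu
  rw [interpH, key, baseEnergy]
  ring

lemma calL_eq (hRu : 0 < Ru) (ω : Disorder nu nv) (x : (Fin nu → ℝ) × (Fin nv → ℝ)) :
    calL n nv au Ru x.2 ω.2.1 ω.2.2.2.2
      = -(1 / (2 * n * Real.sqrt Ru))
        * (2 * Real.sqrt Ru * signalWeight au ω x + noiseWeight au ω x) := by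
  have hs := Real.sqrt_pos.2 hRu
  rw [calL, Real.sqrt_div' _ hRu.le]
  simp only [signalWeight, noiseWeight, Finset.mul_sum, ← Finset.sum_add_distrib]
  refine Finset.sum_congr rfl fun j _ => ?_
  rcases eq_or_ne (n : ℝ) 0 with hn | hn
  · simp [hn]
  field_simp
  ring

lemma continuous_baseEnergy : Continuous (baseEnergy n nu nv av t Rv).uncurry := by
  simp only [Function.uncurry_def, baseEnergy]
  fun_prop

lemma continuous_signalWeight : Continuous (signalWeight (nu := nu) (nv := nv) au).uncurry := by
  simp only [Function.uncurry_def, signalWeight]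
  fun_prop

lemma continuous_noiseWeight : Continuous (noiseWeight (nu := nu) (nv := nv) au).uncurry := by
  simp only [Function.uncurry_def, noiseWeight]
  fun_prop

lemma one_le_noiseSize (ω : Disorder nu nv) : 1 ≤ noiseSize ω := by
  have h1 : 0 ≤ ∑ i, ∑ j, |ω.2.2.1 i j| := by positivity
  have h2 : 0 ≤ ∑ i, |ω.2.2.2.1 i| := by positivity
  have h3 : 0 ≤ ∑ j, |ω.2.2.2.2 j| := by positivity
  rw [noiseSize]
  linarith

lemma abs_sum_mul_le {ι : Type*} [Fintype ι] {a z : ι → ℝ} {c : ℝ} (ha : ∀ i, |a i| ≤ c) :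
    |∑ i, a i * z i| ≤ c * ∑ i, |z i| := by
  rw [Finset.mul_sum]
  refine (Finset.abs_sum_le_sum_abs _ _).trans (Finset.sum_le_sum fun i _ => ?_)
  rw [abs_mul]
  exact mul_le_mul_of_nonneg_right (ha i) (abs_nonneg _)

lemma exists_abs_noiseWeight_le (ru rv : ℝ) : ∃ M : ℝ, ∀ ω : Disorder nu nv,
    ∀ x ∈ euclSphere nu ru ×ˢ euclSphere nv rv, |noiseWeight au ω x| ≤ M * noiseSize ω := by
  refine ⟨Real.sqrt au * |rv|, fun ω x hx => ?_⟩
  have h1 : 0 ≤ ∑ i, ∑ j, |ω.2.2.1 i j| := by positivity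
  have h2 : 0 ≤ ∑ i, |ω.2.2.2.1 i| := by positivity
  rw [noiseWeight, abs_mul, abs_of_nonneg (Real.sqrt_nonneg _), mul_assoc]
  refine mul_le_mul_of_nonneg_left ((abs_sum_mul_le
    fun j => abs_apply_le_of_mem_euclSphere hx.2 j).trans ?_) (Real.sqrt_nonneg _)
  refine mul_le_mul_of_nonneg_left ?_ (abs_nonneg _)
  rw [noiseSize]
  linarith

lemma exists_abs_signalWeight_le (ru rv : ℝ) : ∃ M : ℝ, ∀ ω : Disorder nu nv,
    ω.2.1 ∈ euclSphere nv rv →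
    ∀ x ∈ euclSphere nu ru ×ˢ euclSphere nv rv, |signalWeight au ω x| ≤ M * noiseSize ω := by
  obtain ⟨M, hM⟩ := ((isCompact_euclSphere nv rv).prod (isCompact_euclSphere nv rv)
    ).exists_bound_of_continuousOn (f := fun p : (Fin nv → ℝ) × (Fin nv → ℝ) =>
      ∑ j, (au * p.2 j * p.1 j - au / 2 * (p.2 j) ^ 2)) (by fun_prop)
  refine ⟨M, fun ω hω x hx => ?_⟩
  have h := hM (ω.2.1, x.2) ⟨hω, hx.2⟩
  exact h.trans (le_mul_of_one_le_right ((norm_nonneg _).trans h) (one_le_noiseSize ω))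

lemma baseEnergy_eq_add_noise (ω : Disorder nu nv) (x : (Fin nu → ℝ) × (Fin nv → ℝ)) :
    baseEnergy n nu nv av t Rv ω x
      = baseEnergy n nu nv av t Rv (ω.1, ω.2.1, 0, 0, 0) x
        + ∑ i, ∑ j, (-Real.sqrt ((1 - t) / n) * x.1 i * x.2 j) * ω.2.2.1 i j
        + ∑ i, (-Real.sqrt (av * Rv) * x.1 i) * ω.2.2.2.1 i := by
  have hZ : ∑ i, ∑ j, ((1 - t) / (2 * n) * (x.1 i) ^ 2 * (x.2 j) ^ 2
      - Real.sqrt ((1 - t) / n) * x.1 i * x.2 j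
          * (Real.sqrt ((1 - t) / n) * ω.1 i * ω.2.1 j + ω.2.2.1 i j))
      = (∑ i, ∑ j, ((1 - t) / (2 * n) * (x.1 i) ^ 2 * (x.2 j) ^ 2
      - Real.sqrt ((1 - t) / n) * x.1 i * x.2 j
          * (Real.sqrt ((1 - t) / n) * ω.1 i * ω.2.1 j)))
        + ∑ i, ∑ j, (-Real.sqrt ((1 - t) / n) * x.1 i * x.2 j) * ω.2.2.1 i j := by
    simp only [← Finset.sum_add_distrib]
    exact Finset.sum_congr rfl fun i _ => Finset.sum_congr rfl fun j _ => by ring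
  have hZt : ∑ i, (av * Rv / 2 * (x.1 i) ^ 2
      - Real.sqrt (av * Rv) * x.1 i * (Real.sqrt (av * Rv) * ω.1 i + ω.2.2.2.1 i))
      = (∑ i, (av * Rv / 2 * (x.1 i) ^ 2
      - Real.sqrt (av * Rv) * x.1 i * (Real.sqrt (av * Rv) * ω.1 i)))
        + ∑ i, (-Real.sqrt (av * Rv) * x.1 i) * ω.2.2.2.1 i := by
    simp only [← Finset.sum_add_distrib]
    exact Finset.sum_congr rfl fun i _ => by ring
  simp only [baseEnergy, Pi.zero_apply, add_zero]
  rw [hZ, hZt]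
  ring

lemma exists_abs_baseEnergy_le (ru rv : ℝ) : ∃ M : ℝ, ∀ ω : Disorder nu nv,
    ω.1 ∈ euclSphere nu ru → ω.2.1 ∈ euclSphere nv rv →
    ∀ x ∈ euclSphere nu ru ×ˢ euclSphere nv rv,
      |baseEnergy n nu nv av t Rv ω x| ≤ M * noiseSize ω := by
  obtain ⟨M, hM⟩ := ((((isCompact_euclSphere nu ru).prod (isCompact_euclSphere nv rv))).prod
    ((isCompact_euclSphere nu ru).prod (isCompact_euclSphere nv rv))
    ).exists_bound_of_continuousOn
      (f := fun p : ((Fin nu → ℝ) × (Fin nv → ℝ)) × ((Fin nu → ℝ) × (Fin nv → ℝ)) =>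
        baseEnergy n nu nv av t Rv (p.1.1, p.1.2, 0, 0, 0) p.2)
      (continuous_baseEnergy.comp (f := fun p : ((Fin nu → ℝ) × (Fin nv → ℝ)) ×
        ((Fin nu → ℝ) × (Fin nv → ℝ)) => (((p.1.1, p.1.2, 0, 0, 0) : Disorder nu nv), p.2))
        (by fun_prop)).continuousOn
  set a := Real.sqrt ((1 - t) / n) * |ru| * |rv|
  set b := Real.sqrt (av * Rv) * |ru|
  have ha : 0 ≤ a := by positivity
  have hb : 0 ≤ b := by positivity
  refine ⟨M + a + b, fun ω hU hV x hx => ?_⟩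
  have h0 := hM ((ω.1, ω.2.1), x) ⟨⟨hU, hV⟩, hx⟩
  have hM0 : 0 ≤ M := (norm_nonneg _).trans h0
  have hx1 := abs_apply_le_of_mem_euclSphere hx.1
  have hx2 := abs_apply_le_of_mem_euclSphere hx.2
  have h1 : |∑ i, ∑ j, (-Real.sqrt ((1 - t) / n) * x.1 i * x.2 j) * ω.2.2.1 i j|
      ≤ a * ∑ i, ∑ j, |ω.2.2.1 i j| := by
    rw [Finset.mul_sum]
    refine (Finset.abs_sum_le_sum_abs _ _).trans (Finset.sum_le_sum fun i _ =>
      abs_sum_mul_le fun j => ?_)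
    rw [abs_mul, abs_mul, abs_neg, abs_of_nonneg (Real.sqrt_nonneg _)]
    exact mul_le_mul (mul_le_mul_of_nonneg_left (hx1 i) (Real.sqrt_nonneg _)) (hx2 j)
      (abs_nonneg _) (by positivity)
  have h2 : |∑ i, (-Real.sqrt (av * Rv) * x.1 i) * ω.2.2.2.1 i| ≤ b * ∑ i, |ω.2.2.2.1 i| := by
    refine abs_sum_mul_le fun i => ?_
    rw [abs_mul, abs_neg, abs_of_nonneg (Real.sqrt_nonneg _)]
    exact mul_le_mul_of_nonneg_left (hx1 i) (Real.sqrt_nonneg _)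
  have p1 : 0 ≤ ∑ i, ∑ j, |ω.2.2.1 i j| := by positivity
  have p2 : 0 ≤ ∑ i, |ω.2.2.2.1 i| := by positivity
  have p3 : 0 ≤ ∑ j, |ω.2.2.2.2 j| := by positivity
  rw [baseEnergy_eq_add_noise]
  refine (abs_add_three _ _ _).trans ((add_le_add (add_le_add h0 h1) h2).trans ?_)
  rw [add_mul, add_mul]
  refine add_le_add (add_le_add ?_ ?_) ?_
  · exact le_mul_of_one_le_right hM0 (one_le_noiseSize ω)
  · refine mul_le_mul_of_nonneg_left ?_ ha
    rw [noiseSize]; linarith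
  · refine mul_le_mul_of_nonneg_left ?_ hb
    rw [noiseSize]; linarith

/-- A single square-integrable function dominates all parts of the Hamiltonian. -/
lemma exists_common_energy_bound (n : ℕ) (au av t Rv ru rv : ℝ) :
    ∃ M : ℝ, ∀ ω : Disorder nu nv,
    ω.1 ∈ euclSphere nu ru → ω.2.1 ∈ euclSphere nv rv →
    ∀ x ∈ euclSphere nu ru ×ˢ euclSphere nv rv,
      |-baseEnergy n nu nv av t Rv ω x| ≤ M * noiseSize ω ∧
      |signalWeight au ω x| ≤ M * noiseSize ω ∧ |noiseWeight au ω x| ≤ M * noiseSize ω := by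
  obtain ⟨M1, h1⟩ := exists_abs_baseEnergy_le (n := n) (nu := nu) (nv := nv) (av := av) (t := t)
    (Rv := Rv) ru rv
  obtain ⟨M2, h2⟩ := exists_abs_signalWeight_le (nu := nu) (nv := nv) (au := au) ru rv
  obtain ⟨M3, h3⟩ := exists_abs_noiseWeight_le (nu := nu) (nv := nv) (au := au) ru rv
  refine ⟨max M1 (max M2 M3), fun ω hU hV x hx => ?_⟩
  have hN : 0 ≤ noiseSize ω := zero_le_one.trans (one_le_noiseSize ω)
  rw [abs_neg]
  exact ⟨(h1 ω hU hV x hx).trans (mul_le_mul_of_nonneg_right (le_max_left _ _) hN),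
    (h2 ω hV x hx).trans (mul_le_mul_of_nonneg_right
      ((le_max_left _ _).trans (le_max_right _ _)) hN),
    (h3 ω x hx).trans (mul_le_mul_of_nonneg_right
      ((le_max_right _ _).trans (le_max_right _ _)) hN)⟩

end Energy

section Application

/-- The negative Hamiltonian as a polynomial in `σ = √R_u`. -/
def negEnergy (n nu nv : ℕ) (au av t Rv σ : ℝ) (ω : Disorder nu nv)
    (x : (Fin nu → ℝ) × (Fin nv → ℝ)) : ℝ :=
  -baseEnergy n nu nv av t Rv ω x + σ ^ 2 * signalWeight au ω x + σ * noiseWeight au ω x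

variable {n nu nv : ℕ} {au av t Ru Rv ru rv : ℝ}

lemma continuous_negEnergy (σ : ℝ) : Continuous (negEnergy n nu nv au av t Rv σ).uncurry :=
  (continuous_tilt (A := fun ω x => -baseEnergy n nu nv av t Rv ω x) continuous_baseEnergy.neg
    continuous_signalWeight continuous_noiseWeight).comp
    (f := fun p : Disorder nu nv × ((Fin nu → ℝ) × (Fin nv → ℝ)) => ((σ, p.1), p.2))
    (by fun_prop)

lemma continuous_negEnergy_right (σ : ℝ) (ω : Disorder nu nv) :
    Continuous (negEnergy n nu nv au av t Rv σ ω) :=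
  Continuous.uncurry_left ω (continuous_negEnergy σ)

lemma continuous_energyDeriv (σ : ℝ) : Continuous (Function.uncurry
    fun (ω : Disorder nu nv) x => 2 * σ * signalWeight au ω x + noiseWeight au ω x) :=
  (continuous_tilt_deriv continuous_signalWeight continuous_noiseWeight).comp
    (f := fun p : Disorder nu nv × ((Fin nu → ℝ) × (Fin nv → ℝ)) => ((σ, p.1), p.2))
    (by fun_prop)

lemma isCompact_euclSphere_prod :
    IsCompact (euclSphere nu ru ×ˢ euclSphere nv rv) :=
  (isCompact_euclSphere nu ru).prod (isCompact_euclSphere nv rv)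

lemma ae_mem_euclSphere_prod {Pu : Measure (Fin nu → ℝ)} {Pv : Measure (Fin nv → ℝ)}
    (hu : ∀ᵐ x ∂Pu, x ∈ euclSphere nu ru) (hv : ∀ᵐ x ∂Pv, x ∈ euclSphere nv rv) :
    ∀ᵐ x ∂(Pu.prod Pv), x ∈ euclSphere nu ru ×ˢ euclSphere nv rv :=
  (Measure.quasiMeasurePreserving_fst.ae hu).and (Measure.quasiMeasurePreserving_snd.ae hv)

variable {Pu : Measure (Fin nu → ℝ)} {Pv : Measure (Fin nv → ℝ)}
  [IsProbabilityMeasure Pu] [IsProbabilityMeasure Pv]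

lemma exists_memLp_energy_bound (n : ℕ) (au av t Rv : ℝ)
    (hu : ∀ᵐ x ∂Pu, x ∈ euclSphere nu ru) (hv : ∀ᵐ x ∂Pv, x ∈ euclSphere nv rv) :
    ∃ W : Disorder nu nv → ℝ, MemLp W 2 (disorderLaw Pu Pv) ∧
      (∀ᵐ ω ∂(disorderLaw Pu Pv), ∀ x ∈ euclSphere nu ru ×ˢ euclSphere nv rv,
        |-baseEnergy n nu nv av t Rv ω x| ≤ W ω) ∧
      (∀ᵐ ω ∂(disorderLaw Pu Pv), ∀ x ∈ euclSphere nu ru ×ˢ euclSphere nv rv,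
        |signalWeight au ω x| ≤ W ω) ∧
      ∀ᵐ ω ∂(disorderLaw Pu Pv), ∀ x ∈ euclSphere nu ru ×ˢ euclSphere nv rv,
        |noiseWeight au ω x| ≤ W ω := by
  obtain ⟨M, hM⟩ := exists_common_energy_bound (nu := nu) (nv := nv) n au av t Rv ru rv
  have hae := ae_mem_of_ae_disorderLaw hu hv
  exact ⟨fun ω => M * noiseSize ω, memLp_noiseSize.const_mul M,
    hae.mono fun ω hω x hx => (hM ω hω.1 hω.2 x hx).1,
    hae.mono fun ω hω x hx => (hM ω hω.1 hω.2 x hx).2.1,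
    hae.mono fun ω hω x hx => (hM ω hω.1 hω.2 x hx).2.2⟩

lemma partFun_eq_integral (hu : ∀ᵐ x ∂Pu, x ∈ euclSphere nu ru)
    (hv : ∀ᵐ x ∂Pv, x ∈ euclSphere nv rv) (hau : 0 ≤ au) (hRu : 0 ≤ Ru)
    (U : Fin nu → ℝ) (V : Fin nv → ℝ) (Z : Fin nu → Fin nv → ℝ) (Zt : Fin nu → ℝ)
    (Zb : Fin nv → ℝ) :
    partFun n nu nv au av t Ru Rv Pu Pv U V Z Zt Zb
      = ∫ x, Real.exp (negEnergy n nu nv au av t Rv (Real.sqrt Ru) (U, V, Z, Zt, Zb) x)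
          ∂(Pu.prod Pv) := by
  have hh := continuous_negEnergy_right (n := n) (au := au) (av := av) (t := t) (Rv := Rv)
    (Real.sqrt Ru) (U, V, Z, Zt, Zb)
  have hint : Integrable (fun x => Real.exp (negEnergy n nu nv au av t Rv (Real.sqrt Ru)
      (U, V, Z, Zt, Zb) x)) (Pu.prod Pv) :=
    integrable_of_continuous_of_ae_mem_compact isCompact_euclSphere_prod
      (ae_mem_euclSphere_prod hu hv) (by fun_prop)
  rw [integral_prod _ hint, partFun]
  congr! with u v
  exact neg_interpH_eq hau hRu (U, V, Z, Zt, Zb) (u, v)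

lemma gibbs_eq_gibbsMean (hu : ∀ᵐ x ∂Pu, x ∈ euclSphere nu ru)
    (hv : ∀ᵐ x ∂Pv, x ∈ euclSphere nv rv) (hau : 0 ≤ au) (hRu : 0 ≤ Ru)
    {f : (Fin nu → ℝ) × (Fin nv → ℝ) → ℝ} (hf : Continuous f)
    (U : Fin nu → ℝ) (V : Fin nv → ℝ) (Z : Fin nu → Fin nv → ℝ) (Zt : Fin nu → ℝ)
    (Zb : Fin nv → ℝ) :
    gibbs n nu nv au av t Ru Rv Pu Pv U V Z Zt Zb (fun u v => f (u, v))
      = gibbsMean (Pu.prod Pv) f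
          (negEnergy n nu nv au av t Rv (Real.sqrt Ru) (U, V, Z, Zt, Zb)) := by
  have hh := continuous_negEnergy_right (n := n) (au := au) (av := av) (t := t) (Rv := Rv)
    (Real.sqrt Ru) (U, V, Z, Zt, Zb)
  have hint : Integrable (fun x => f x * Real.exp (negEnergy n nu nv au av t Rv (Real.sqrt Ru)
      (U, V, Z, Zt, Zb) x)) (Pu.prod Pv) :=
    integrable_of_continuous_of_ae_mem_compact isCompact_euclSphere_prod
      (ae_mem_euclSphere_prod hu hv) (by fun_prop)
  rw [gibbs, partFun_eq_integral hu hv hau hRu, gibbsMean, integral_prod _ hint]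
  congr! with u v
  exact neg_interpH_eq hau hRu (U, V, Z, Zt, Zb) (u, v)

/-- The free entropy as a function of `σ = √R_u`. -/
lemma interpFreeEntropy_eq (hu : ∀ᵐ x ∂Pu, x ∈ euclSphere nu ru)
    (hv : ∀ᵐ x ∂Pv, x ∈ euclSphere nv rv) (hau : 0 ≤ au) (hRu : 0 ≤ Ru) :
    interpFreeEntropy n nu nv au av t Ru Rv Pu Pv
      = 1 / n * ∫ ω, Real.log (∫ x, Real.exp
          (negEnergy n nu nv au av t Rv (Real.sqrt Ru) ω x) ∂(Pu.prod Pv)) ∂(disorderLaw Pu Pv) := by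
  obtain ⟨W, hW, hA, hB, hC⟩ := exists_memLp_energy_bound n au av t Rv hu hv
  rw [interpFreeEntropy, Efull_eq_integral (fun U V Z Zt Zb => ?_)
    (integrable_log_partition isCompact_euclSphere_prod (ae_mem_euclSphere_prod hu hv)
      continuous_baseEnergy.neg continuous_signalWeight continuous_noiseWeight
      (hW.integrable one_le_two) hA hB hC (Real.sqrt Ru))]
  · rfl
  · rw [partFun_eq_integral hu hv hau hRu]
    rfl

/-- The thermal variance of `𝓛` through the derivative of the energy in `σ`. -/
lemma thermalVarL_eq (hu : ∀ᵐ x ∂Pu, x ∈ euclSphere nu ru)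
    (hv : ∀ᵐ x ∂Pv, x ∈ euclSphere nv rv) (hau : 0 ≤ au) (hRu : 0 < Ru) :
    thermalVarL n nu nv au av t Ru Rv Pu Pv
      = (1 / (2 * n * Real.sqrt Ru)) ^ 2 * ∫ ω, (gibbsMean (Pu.prod Pv)
          (fun x => (2 * Real.sqrt Ru * signalWeight au ω x + noiseWeight au ω x) ^ 2)
          (negEnergy n nu nv au av t Rv (Real.sqrt Ru) ω)
        - gibbsMean (Pu.prod Pv)
          (fun x => 2 * Real.sqrt Ru * signalWeight au ω x + noiseWeight au ω x)
          (negEnergy n nu nv au av t Rv (Real.sqrt Ru) ω) ^ 2) ∂(disorderLaw Pu Pv) := by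
  obtain ⟨W, hW, -, hB, hC⟩ := exists_memLp_energy_bound n au av t Rv hu hv
  have hK := isCompact_euclSphere_prod (nu := nu) (nv := nv) (ru := ru) (rv := rv)
  have hμ := ae_mem_euclSphere_prod hu hv
  set σ := Real.sqrt Ru
  have hh := continuous_negEnergy (n := n) (nu := nu) (nv := nv) (au := au) (av := av) (t := t)
    (Rv := Rv) σ
  have hg := continuous_energyDeriv (nu := nu) (nv := nv) (au := au) σ
  have hgω (ω : Disorder nu nv) :
      Continuous fun x => 2 * σ * signalWeight au ω x + noiseWeight au ω x :=
    hg.comp (Continuous.prodMk_right ω)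
  have hgW : ∀ᵐ ω ∂(disorderLaw Pu Pv), ∀ x ∈ euclSphere nu ru ×ˢ euclSphere nv rv,
      |2 * σ * signalWeight au ω x + noiseWeight au ω x| ≤ (2 * |σ| + 1) * W ω := by
    filter_upwards [hB, hC] with ω hb hc x hx
    exact abs_tilt_deriv_le le_rfl (hb x hx) (hc x hx)
  have hi := (integrable_gibbsMean_sq hK hμ hg hh (hW.const_mul _) hgW).sub
    (memLp_gibbsMean hK hμ hg hh (hW.const_mul _) hgW).integrable_sq
  rw [thermalVarL, ← integral_const_mul]
  refine Efull_eq_integral (fun U V Z Zt Zb => ?_) (hi.const_mul _)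
  have hL (x : (Fin nu → ℝ) × (Fin nv → ℝ)) : calL n nv au Ru x.2 V Zb
      = -(1 / (2 * n * σ)) * (2 * σ * signalWeight au (U, V, Z, Zt, Zb) x
        + noiseWeight au (U, V, Z, Zt, Zb) x) := calL_eq hRu (U, V, Z, Zt, Zb) x
  have hLc : Continuous fun x : (Fin nu → ℝ) × (Fin nv → ℝ) => calL n nv au Ru x.2 V Zb := by
    simp only [hL]; exact continuous_const.mul (hgω _)
  have hm := gibbs_eq_gibbsMean (n := n) (av := av) (t := t) (Rv := Rv) hu hv hau hRu.le hLc
    U V Z Zt Zb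
  dsimp only at hm
  rw [hm, gibbs_eq_gibbsMean (f := fun x => (calL n nv au Ru x.2 V Zb - gibbsMean (Pu.prod Pv)
    (fun x => calL n nv au Ru x.2 V Zb) (negEnergy n nu nv au av t Rv σ (U, V, Z, Zt, Zb))) ^ 2)
    hu hv hau hRu.le (by fun_prop), gibbsMean_sub_gibbsMean_sq hK hμ hLc (continuous_negEnergy_right _ _)]
  simp only [hL, mul_pow, gibbsMean_const_mul, neg_sq]
  exact (mul_sub ((1 / (2 * n * σ)) ^ 2 : ℝ) _ _).symm

/-- The noise part of the first derivative in `σ`. -/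
lemma sqrt_mul_Efull_sum_gibbs_mul (hu : ∀ᵐ x ∂Pu, x ∈ euclSphere nu ru)
    (hv : ∀ᵐ x ∂Pv, x ∈ euclSphere nv rv) (hau : 0 ≤ au) (hRu : 0 ≤ Ru) :
    Real.sqrt au * Efull nu nv Pu Pv (fun U V Z Zt Zb =>
        ∑ j, gibbs n nu nv au av t Ru Rv Pu Pv U V Z Zt Zb (fun _ v => v j) * Zb j)
      = ∫ ω, gibbsMean (Pu.prod Pv) (noiseWeight au ω)
          (negEnergy n nu nv au av t Rv (Real.sqrt Ru) ω) ∂(disorderLaw Pu Pv) := by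
  obtain ⟨W, hW, -, -, hC⟩ := exists_memLp_energy_bound n au av t Rv hu hv
  have hi := integrable_gibbsMean isCompact_euclSphere_prod (ae_mem_euclSphere_prod hu hv)
    continuous_noiseWeight (continuous_negEnergy (n := n) (au := au) (av := av) (t := t)
      (Rv := Rv) (Real.sqrt Ru)) (hW.integrable one_le_two) hC
  rw [← Efull_eq_integral (f := fun U V Z Zt Zb => Real.sqrt au * ∑ j, gibbs n nu nv au av t Ru Rv
    Pu Pv U V Z Zt Zb (fun _ v => v j) * Zb j) (fun U V Z Zt Zb => ?_) hi]
  · simp only [Efull, integral_const_mul]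
  · have hj (j : Fin nv) : Continuous fun x : (Fin nu → ℝ) × (Fin nv → ℝ) => x.2 j := by fun_prop
    simp only [fun j => gibbs_eq_gibbsMean (n := n) (av := av) (t := t) (Rv := Rv) hu hv hau hRu
      (hj j) U V Z Zt Zb]
    have hw : noiseWeight au (U, V, Z, Zt, Zb)
        = fun x : (Fin nu → ℝ) × (Fin nv → ℝ) => Real.sqrt au * ∑ j, Zb j * x.2 j := by
      ext x
      simp only [noiseWeight, mul_comm]
    rw [hw, gibbsMean_const_mul, gibbsMean_sum _ isCompact_euclSphere_prod
      (ae_mem_euclSphere_prod hu hv) (fun j => by fun_prop) (continuous_negEnergy_right _ _)]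
    simp only [gibbsMean_const_mul, mul_comm]

lemma Efull_gibbs_sum_sq (hu : ∀ᵐ x ∂Pu, x ∈ euclSphere nu ru)
    (hv : ∀ᵐ x ∂Pv, x ∈ euclSphere nv rv) (hau : 0 ≤ au) (hRu : 0 ≤ Ru) :
    Efull nu nv Pu Pv (fun U V Z Zt Zb =>
      gibbs n nu nv au av t Ru Rv Pu Pv U V Z Zt Zb (fun _ v => ∑ j, (v j) ^ 2)) = rv ^ 2 := by
  rw [Efull_eq_integral (g := fun _ => rv ^ 2) (fun U V Z Zt Zb => ?_) (integrable_const _)]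
  · simp
  · rw [gibbs_eq_gibbsMean (f := fun x => ∑ j, (x.2 j) ^ 2) hu hv hau hRu (by fun_prop)]
    exact gibbsMean_eq_const isCompact_euclSphere_prod (ae_mem_euclSphere_prod hu hv)
      (continuous_negEnergy_right _ _) fun x hx => hx.2

lemma Efull_sum_gibbs_mul (hu : ∀ᵐ x ∂Pu, x ∈ euclSphere nu ru)
    (hv : ∀ᵐ x ∂Pv, x ∈ euclSphere nv rv) (hau : 0 ≤ au) (hRu : 0 ≤ Ru) :
    Efull nu nv Pu Pv (fun U V Z Zt Zb =>
        ∑ j, gibbs n nu nv au av t Ru Rv Pu Pv U V Z Zt Zb (fun _ v => v j) * Zb j)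
      = Real.sqrt Ru * Real.sqrt au * (rv ^ 2 - Efull nu nv Pu Pv (fun U V Z Zt Zb =>
        ∑ j, gibbs n nu nv au av t Ru Rv Pu Pv U V Z Zt Zb (fun _ v => v j) ^ 2)) := by
  have hK := isCompact_euclSphere_prod (nu := nu) (nv := nv) (ru := ru) (rv := rv)
  have hμ := ae_mem_euclSphere_prod hu hv
  have hj (j : Fin nv) : Continuous fun x : (Fin nu → ℝ) × (Fin nv → ℝ) => x.2 j := by fun_prop
  simp only [fun U V Z Zt Zb j => gibbs_eq_gibbsMean (n := n) (av := av) (t := t) (Rv := Rv)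
    hu hv hau hRu (hj j) U V Z Zt Zb]
  set σ := Real.sqrt Ru
  set H := negEnergy n nu nv au av t Rv σ
  have hE (U : Fin nu → ℝ) (V : Fin nv → ℝ) (Z : Fin nu → Fin nv → ℝ) (Zt : Fin nu → ℝ)
      (Zb : Fin nv → ℝ) : H (U, V, Z, Zt, Zb) = fun x =>
        (-baseEnergy n nu nv av t Rv (U, V, Z, Zt, 0) x
          + σ ^ 2 * signalWeight au (U, V, Z, Zt, 0) x)
        + (σ * Real.sqrt au) * ∑ k, x.2 k * Zb k :=
    funext fun x => by rw [mul_assoc]; rfl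
  have ha (ω : Disorder nu nv) : Continuous fun x =>
      -baseEnergy n nu nv av t Rv ω x + σ ^ 2 * signalWeight au ω x :=
    (Continuous.uncurry_left ω continuous_baseEnergy).neg.add
      (continuous_const.mul (Continuous.uncurry_left ω continuous_signalWeight))
  have hsq (ω : Disorder nu nv) :
      ∑ j, gibbsMean (Pu.prod Pv) (fun x => x.2 j ^ 2) (H ω) = rv ^ 2 := by
    rw [← gibbsMean_sum _ hK hμ (fun j => by fun_prop) (continuous_negEnergy_right _ _)]
    exact gibbsMean_eq_const hK hμ (continuous_negEnergy_right _ _) fun x hx => hx.2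
  have hstein (U : Fin nu → ℝ) (V : Fin nv → ℝ) (Z : Fin nu → Fin nv → ℝ) (Zt : Fin nu → ℝ) :
      ∫ Zb, ∑ j, gibbsMean (Pu.prod Pv) (fun x => x.2 j) (H (U, V, Z, Zt, Zb)) * Zb j
          ∂(stdGaussian nv)
        = ∫ Zb, σ * Real.sqrt au * (rv ^ 2
          - ∑ j, gibbsMean (Pu.prod Pv) (fun x => x.2 j) (H (U, V, Z, Zt, Zb)) ^ 2)
          ∂(stdGaussian nv) := by
    have key := integral_sum_gibbsMean_mul_eval hK hμ (ha (U, V, Z, Zt, 0)) (σ * Real.sqrt au)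
      continuous_snd
    simpa only [← hE U V Z Zt, hsq] using key
  have hi : Integrable (fun ω => ∑ j, gibbsMean (Pu.prod Pv) (fun x => x.2 j) (H ω) ^ 2)
      (disorderLaw Pu Pv) :=
    integrable_finsetSum _ fun j _ => (memLp_gibbsMean hK hμ (f := fun _ x => x.2 j)
      ((hj j).comp continuous_snd) (continuous_negEnergy σ) (memLp_const |rv|)
      (Eventually.of_forall fun _ x hx => abs_apply_le_of_mem_euclSphere hx.2 j)).integrable_sq
  simp only [Efull, hstein]
  refine (Efull_eq_integral (fun _ _ _ _ _ => rfl)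
    (((integrable_const (rv ^ 2)).sub hi).const_mul (σ * Real.sqrt au))).trans ?_
  have hQ := Efull_eq_integral (fun _ _ _ _ _ => rfl) hi
  rw [Efull] at hQ
  rw [hQ, integral_const_mul]
  congr 1
  refine (integral_sub (integrable_const _) hi).trans ?_
  simp

lemma hasDerivAt_comp_sqrt_mul {G : ℝ → ℝ} {G' r : ℝ} (hr : 0 < r)
    (hG : HasDerivAt G G' (Real.sqrt r)) :
    HasDerivAt (fun s => G (Real.sqrt s) * (1 / (2 * Real.sqrt s)))
      (G' / (4 * r) - G (Real.sqrt r) / (4 * r * Real.sqrt r)) r := by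
  have hs := Real.sqrt_pos.2 hr
  have h1 := (Real.hasDerivAt_sqrt hr.ne')
  have h2 := (hG.comp r h1).mul ((hasDerivAt_const r (1 : ℝ)).div (h1.const_mul 2)
    (by positivity))
  convert! h2 using 1
  have e : r = Real.sqrt r ^ 2 := (Real.sq_sqrt hr.le).symm
  simp only [Function.comp_apply, Pi.div_apply]
  generalize Real.sqrt r = q at *
  subst e
  field_simp
  ring

lemma corrTerm_eq (hu : ∀ᵐ x ∂Pu, x ∈ euclSphere nu ru)
    (hv : ∀ᵐ x ∂Pv, x ∈ euclSphere nv rv) (hau : 0 ≤ au) (hRu : 0 < Ru) :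
    corrTerm n nu nv au av t Ru Rv Pu Pv
      = (au / (4 * Ru)) * (rv ^ 2 - Efull nu nv Pu Pv (fun U V Z Zt Zb =>
        ∑ j, gibbs n nu nv au av t Ru Rv Pu Pv U V Z Zt Zb (fun _ v => v j) ^ 2)) / n := by
  have hs := Real.sqrt_pos.2 hRu
  rw [corrTerm, Efull_sum_gibbs_mul hu hv hau hRu.le, Real.sqrt_div' _ hRu.le]
  congr 1
  generalize Efull _ _ _ _ _ = E
  field_simp
  linear_combination (rv ^ 2 - E) * Real.sq_sqrt hau

/-- The mean derivative of `-H` in `σ`. -/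
def energyDerivMean (n nu nv : ℕ) (au av t Rv : ℝ) (Pu : Measure (Fin nu → ℝ))
    (Pv : Measure (Fin nv → ℝ)) (σ : ℝ) : ℝ :=
  ∫ ω, gibbsMean (Pu.prod Pv) (fun x => 2 * σ * signalWeight au ω x + noiseWeight au ω x)
    (negEnergy n nu nv au av t Rv σ ω) ∂(disorderLaw Pu Pv)

lemma hasDerivAt_interpFreeEntropy (hu : ∀ᵐ x ∂Pu, x ∈ euclSphere nu ru)
    (hv : ∀ᵐ x ∂Pv, x ∈ euclSphere nv rv) (hau : 0 ≤ au) (hRu : 0 < Ru) :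
    HasDerivAt (fun s => interpFreeEntropy n nu nv au av t s Rv Pu Pv)
      (1 / n * (energyDerivMean n nu nv au av t Rv Pu Pv (Real.sqrt Ru)
        * (1 / (2 * Real.sqrt Ru)))) Ru := by
  obtain ⟨W, hW, hA, hB, hC⟩ := exists_memLp_energy_bound n au av t Rv hu hv
  have hF := hasDerivAt_integral_log_partition isCompact_euclSphere_prod
    (ae_mem_euclSphere_prod hu hv) continuous_baseEnergy.neg continuous_signalWeight
    continuous_noiseWeight hW hA hB hC (Real.sqrt Ru)
  refine ((hF.comp Ru (Real.hasDerivAt_sqrt hRu.ne')).const_mul (1 / (n : ℝ))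
    ).congr_of_eventuallyEq ?_
  filter_upwards [Ioi_mem_nhds hRu] with s hs
  exact interpFreeEntropy_eq hu hv hau (le_of_lt hs)

lemma hasDerivAt_energyDerivMean_comp_sqrt (hn : n ≠ 0)
    (hu : ∀ᵐ x ∂Pu, x ∈ euclSphere nu ru)
    (hv : ∀ᵐ x ∂Pv, x ∈ euclSphere nv rv) (hau : 0 ≤ au) (hRu : 0 < Ru) :
    HasDerivAt (fun r => 1 / n * (energyDerivMean n nu nv au av t Rv Pu Pv (Real.sqrt r)
        * (1 / (2 * Real.sqrt r))))
      (n * thermalVarL n nu nv au av t Ru Rv Pu Pv - corrTerm n nu nv au av t Ru Rv Pu Pv)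
      Ru := by
  obtain ⟨W, hW, -, hB, hC⟩ := exists_memLp_energy_bound n au av t Rv hu hv
  have hW1 := hW.integrable one_le_two
  have hK := isCompact_euclSphere_prod (nu := nu) (nv := nv) (ru := ru) (rv := rv)
  have hμ := ae_mem_euclSphere_prod hu hv
  have hG := hasDerivAt_integral_gibbsMean (A := fun ω x => -baseEnergy n nu nv av t Rv ω x)
    hK hμ continuous_baseEnergy.neg continuous_signalWeight continuous_noiseWeight hW hB hC
    (Real.sqrt Ru)
  have hth := thermalVarL_eq (n := n) (av := av) (t := t) (Rv := Rv) hu hv hau hRu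
  have hc := sqrt_mul_Efull_sum_gibbs_mul (n := n) (av := av) (t := t) (Rv := Rv) hu hv hau
    hRu.le
  have hσ := Real.sqrt_pos.2 hRu
  have hσ2 := Real.sq_sqrt hRu.le
  rw [corrTerm, Real.sqrt_div' _ hRu.le, hth]
  refine ((hasDerivAt_comp_sqrt_mul hRu hG).const_mul (1 / (n : ℝ))).congr_deriv ?_
  set σ := Real.sqrt Ru
  set H := negEnergy n nu nv au av t Rv σ
  have hh : Continuous H.uncurry := continuous_negEnergy σ
  have hHω (ω : Disorder nu nv) : Continuous (H ω) := continuous_negEnergy_right σ ω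
  have hSω (ω : Disorder nu nv) : Continuous (signalWeight au ω) :=
    Continuous.uncurry_left ω continuous_signalWeight
  have hNω (ω : Disorder nu nv) : Continuous (noiseWeight au ω) :=
    Continuous.uncurry_left ω continuous_noiseWeight
  have hg := continuous_energyDeriv (nu := nu) (nv := nv) (au := au) σ
  have hgW : ∀ᵐ ω ∂(disorderLaw Pu Pv), ∀ x ∈ euclSphere nu ru ×ˢ euclSphere nv rv,
      |2 * σ * signalWeight au ω x + noiseWeight au ω x| ≤ (2 * |σ| + 1) * W ω := by
    filter_upwards [hB, hC] with ω hb hc x hx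
    exact abs_tilt_deriv_le le_rfl (hb x hx) (hc x hx)
  have iS := integrable_gibbsMean hK hμ continuous_signalWeight hh hW1 hB
  have iN := integrable_gibbsMean hK hμ continuous_noiseWeight hh hW1 hC
  have iV := (integrable_gibbsMean_sq hK hμ hg hh (hW.const_mul _) hgW).sub
    (memLp_gibbsMean hK hμ hg hh (hW.const_mul _) hgW).integrable_sq
  have e1 : ∫ ω, gibbsMean (Pu.prod Pv)
      (fun x => 2 * σ * signalWeight au ω x + noiseWeight au ω x) (H ω) ∂(disorderLaw Pu Pv)
      = 2 * σ * ∫ ω, gibbsMean (Pu.prod Pv) (signalWeight au ω) (H ω) ∂(disorderLaw Pu Pv)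
        + ∫ ω, gibbsMean (Pu.prod Pv) (noiseWeight au ω) (H ω) ∂(disorderLaw Pu Pv) := by
    rw [← integral_const_mul, ← integral_add (iS.const_mul _) iN]
    refine integral_congr_ae (Eventually.of_forall fun ω => ?_)
    dsimp only
    rw [gibbsMean_add hK hμ (f := fun x => 2 * σ * signalWeight au ω x)
      (continuous_const.mul (hSω ω)) (hNω ω) (hHω ω), gibbsMean_const_mul]
  have e2 : ∫ ω, (gibbsMean (Pu.prod Pv) (fun x => 2 * signalWeight au ω x) (H ω)
        + gibbsMean (Pu.prod Pv)
          (fun x => (2 * σ * signalWeight au ω x + noiseWeight au ω x) ^ 2) (H ω)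
        - gibbsMean (Pu.prod Pv)
          (fun x => 2 * σ * signalWeight au ω x + noiseWeight au ω x) (H ω) ^ 2)
        ∂(disorderLaw Pu Pv)
      = 2 * ∫ ω, gibbsMean (Pu.prod Pv) (signalWeight au ω) (H ω) ∂(disorderLaw Pu Pv)
        + ∫ ω, (gibbsMean (Pu.prod Pv)
          (fun x => (2 * σ * signalWeight au ω x + noiseWeight au ω x) ^ 2) (H ω)
        - gibbsMean (Pu.prod Pv)
          (fun x => 2 * σ * signalWeight au ω x + noiseWeight au ω x) (H ω) ^ 2)
        ∂(disorderLaw Pu Pv) := by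
    rw [← integral_const_mul]
    refine Eq.trans ?_ (integral_add (iS.const_mul _) iV)
    refine integral_congr_ae (Eventually.of_forall fun ω => ?_)
    dsimp only [Pi.sub_apply]
    rw [gibbsMean_const_mul, add_sub_assoc]
  refine (congrArg₂ (fun a b => 1 / (n : ℝ) * (a / (4 * Ru) - b / (4 * Ru * σ))) e2 e1).trans ?_
  rw [← hc]
  generalize Efull _ _ _ _ _ = E
  generalize ∫ ω, gibbsMean (Pu.prod Pv) (signalWeight au ω) (H ω) ∂(disorderLaw Pu Pv) = b
  generalize ∫ ω, (_ : ℝ) ∂(disorderLaw Pu Pv) = w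
  have hn' : (n : ℝ) ≠ 0 := by exact_mod_cast hn
  clear_value σ
  subst hσ2
  field_simp
  ring

end Application

/-- **second derivative of the free entropy in `R_u`.** For all
`t ∈ [0,1]` and `R ∈ (0,∞)²`:
`∂²fₙ/∂R_u² = n E⟨(𝓛 − ⟨𝓛⟩)²⟩ − (1/(4R_u))√(α_u/R_u) E[⟨v⟩ᵀ Z̄]/n`, and the
correction term equals `(α_u/(4R_u))(E⟨‖v‖²⟩ − E‖⟨v⟩‖²)/n ≤ α_u ρ_v n_v/(4 R_u n)`. -/
theorem free_entropy_Ru_second_derivative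
    (n nu nv : ℕ) (hn : 0 < n) (hnu : 0 < nu) (hnv : 0 < nv)
    (au av ru rv : ℝ) (hau : 0 < au) (hav : 0 < av) (hru : 0 < ru) (hrv : 0 < rv)
    (Pu : Measure (Fin nu → ℝ)) (Pv : Measure (Fin nv → ℝ))
    (hPu : IsUniformSphere nu (Real.sqrt (ru * nu)) Pu)
    (hPv : IsUniformSphere nv (Real.sqrt (rv * nv)) Pv)
    (t : ℝ) (ht : t ∈ Icc (0:ℝ) 1) (Ru Rv : ℝ) (hRu : 0 < Ru) (hRv : 0 < Rv) :
    (∃ D1 : ℝ → ℝ,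
      (∀ r ∈ Ioi (0:ℝ),
        HasDerivAt (fun s => interpFreeEntropy n nu nv au av t s Rv Pu Pv) (D1 r) r) ∧
      HasDerivAt D1
        ((n : ℝ) * thermalVarL n nu nv au av t Ru Rv Pu Pv
          - corrTerm n nu nv au av t Ru Rv Pu Pv) Ru) ∧
    corrTerm n nu nv au av t Ru Rv Pu Pv
        = (au / (4 * Ru)) *
          (Efull nu nv Pu Pv (fun U V Z Zt Zb =>
              gibbs n nu nv au av t Ru Rv Pu Pv U V Z Zt Zb (fun _ v => ∑ j, (v j) ^ 2))
            - Efull nu nv Pu Pv (fun U V Z Zt Zb =>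
              ∑ j, (gibbs n nu nv au av t Ru Rv Pu Pv U V Z Zt Zb (fun _ v => v j)) ^ 2))
          / (n : ℝ) ∧
    corrTerm n nu nv au av t Ru Rv Pu Pv ≤ au * rv * (nv : ℝ) / (4 * Ru * n) := by
  obtain ⟨hPu_prob, hu, -⟩ := hPu
  obtain ⟨hPv_prob, hv, -⟩ := hPv
  have hcorr := corrTerm_eq (n := n) (av := av) (t := t) (Rv := Rv) hu hv hau.le hRu
  refine ⟨⟨_, fun r hr => hasDerivAt_interpFreeEntropy hu hv hau.le hr,
    hasDerivAt_energyDerivMean_comp_sqrt hn.ne' hu hv hau.le hRu⟩, ?_, ?_⟩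
  · rw [hcorr, Efull_gibbs_sum_sq hu hv hau.le hRu.le]
  · have hE : 0 ≤ Efull nu nv Pu Pv (fun U V Z Zt Zb =>
        ∑ j, (gibbs n nu nv au av t Ru Rv Pu Pv U V Z Zt Zb (fun _ v => v j)) ^ 2) := by
      unfold Efull
      positivity
    rw [hcorr, Real.sq_sqrt (by positivity),
      show au * rv * (nv : ℝ) / (4 * Ru * n) = au / (4 * Ru) * (rv * nv) / n by field_simp]
    gcongr
    linarith

end
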